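/- Fix n ∈ ℕ. Let M ⊨ IΔ0 + exp, K ⊨ IΣ_n, and M ⊆_e K an end extension. Then the following are equivalent: (1) K ⊨ M-IΣ_{n+1}, i.e., for every Σ_{n+1} formula φ(x) with parameters from K and every a ∈ M, K ⊨ (φ(0) ∧ ∀x<a (φ(x)→φ(x+1))) → ∀x<a φ(x); (2) for every Σ_{n+1} formula φ(x) with parameters from K and every a ∈ M, K ⊨ ∃c ∀x<a (φ(x) ↔ x ∈ c), where x ∈ c means the x-th binary digit of c is 1; (3) for every Π_n formula θ(x,y) with parameters from K and every a ∈ M, K ⊨ ∃b ∀x<a (∃y θ(x,y) ↔ ∃y<b θ(x,y)). -/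

import Mathlib

namespace PaperArith

/-! ## Syntax of (two-sorted) first-order arithmetic

Terms and formulas of arithmetic in the language `{0, 1, +, ·, <}`,
with number variables and (monadic second-order) set variables both indexed
by natural numbers.  Bounded quantifiers are taken as primitives, so that the
class `Δ₀` of bounded formulas is a purely syntactic class. -/

/-- Terms of first-order arithmetic in the language `{0, 1, +, ·, <}`. -/
inductive Term : Type
  | var : ℕ → Term
  | zero : Term
  | one : Term
  | add : Term → Term → Term
  | mul : Term → Term → Term

/-- Formulas of (two-sorted) arithmetic.  `mem t i` is the atomic formula
`t ∈ Xᵢ`; `ball x t φ` is `∀ x < t, φ` and `bex x t φ` is `∃ x < t, φ`;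
`sall i φ` and `sex i φ` quantify over the set variable `Xᵢ`.
Purely first-order formulas are those avoiding `mem`, `sall`, `sex`. -/
inductive Fml : Type
  | eq : Term → Term → Fml
  | lt : Term → Term → Fml
  | mem : Term → ℕ → Fml
  | not : Fml → Fml
  | and : Fml → Fml → Fml
  | or : Fml → Fml → Fml
  | imp : Fml → Fml → Fml
  | all : ℕ → Fml → Fml
  | ex : ℕ → Fml → Fml
  | ball : ℕ → Term → Fml → Fml
  | bex : ℕ → Term → Fml → Fml
  | sall : ℕ → Fml → Fml
  | sex : ℕ → Fml → Fml

/-- A structure for the first-order language of arithmetic. -/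
structure Str : Type 1 where
  M : Type
  zero : M
  one : M
  add : M → M → M
  mul : M → M → M
  lt : M → M → Prop

/-- Value of a term under a valuation of the number variables. -/
def tval (S : Str) (v : ℕ → S.M) : Term → S.M
  | .var i => v i
  | .zero => S.zero
  | .one => S.one
  | .add t u => S.add (tval S v t) (tval S v u)
  | .mul t u => S.mul (tval S v t) (tval S v u)

/-- Update a valuation at one variable. -/
def upd {α : Type} (v : ℕ → α) (x : ℕ) (a : α) : ℕ → α :=
  fun i => if i = x then a else v i

/-- Tarskian satisfaction over the structure `S`, with second-order universe
`X` (set quantifiers range over `X`); `v` is the valuation of number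
variables, `w` the valuation of set variables. -/
def Sat (S : Str) (X : Set (Set S.M)) : (ℕ → S.M) → (ℕ → Set S.M) → Fml → Prop
  | v, _, .eq t u => tval S v t = tval S v u
  | v, _, .lt t u => S.lt (tval S v t) (tval S v u)
  | v, w, .mem t i => tval S v t ∈ w i
  | v, w, .not φ => ¬ Sat S X v w φ
  | v, w, .and φ ψ => Sat S X v w φ ∧ Sat S X v w ψ
  | v, w, .or φ ψ => Sat S X v w φ ∨ Sat S X v w ψ
  | v, w, .imp φ ψ => Sat S X v w φ → Sat S X v w ψ
  | v, w, .all x φ => ∀ m : S.M, Sat S X (upd v x m) w φ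
  | v, w, .ex x φ => ∃ m : S.M, Sat S X (upd v x m) w φ
  | v, w, .ball x t φ => ∀ m : S.M, S.lt m (tval S v t) → Sat S X (upd v x m) w φ
  | v, w, .bex x t φ => ∃ m : S.M, S.lt m (tval S v t) ∧ Sat S X (upd v x m) w φ
  | v, w, .sall i φ => ∀ A : Set S.M, A ∈ X → Sat S X v (upd w i A) φ
  | v, w, .sex i φ => ∃ A : Set S.M, A ∈ X ∧ Sat S X v (upd w i A) φ

/-- First-order satisfaction (for purely first-order formulas the second-order
data is irrelevant). -/
def Sat0 (S : Str) (v : ℕ → S.M) (φ : Fml) : Prop :=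
  Sat S ∅ v (fun _ => ∅) φ

/-! ## The arithmetic hierarchy -/

/-- `Δ₀` formulas: purely first-order, only bounded quantifiers. -/
inductive Delta0 : Fml → Prop
  | eq (t u : Term) : Delta0 (.eq t u)
  | lt (t u : Term) : Delta0 (.lt t u)
  | not {φ : Fml} : Delta0 φ → Delta0 (.not φ)
  | and {φ ψ : Fml} : Delta0 φ → Delta0 ψ → Delta0 (.and φ ψ)
  | or {φ ψ : Fml} : Delta0 φ → Delta0 ψ → Delta0 (.or φ ψ)
  | imp {φ ψ : Fml} : Delta0 φ → Delta0 ψ → Delta0 (.imp φ ψ)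
  | ball (x : ℕ) (t : Term) {φ : Fml} : Delta0 φ → Delta0 (.ball x t φ)
  | bex (x : ℕ) (t : Term) {φ : Fml} : Delta0 φ → Delta0 (.bex x t φ)

mutual
  /-- `Σₙ` formulas of the first-order arithmetic hierarchy. -/
  inductive IsSigma : ℕ → Fml → Prop
    | delta0 {n : ℕ} {φ : Fml} : Delta0 φ → IsSigma n φ
    | ofPi {n : ℕ} {φ : Fml} : IsPi n φ → IsSigma (n + 1) φ
    | ex (x : ℕ) {n : ℕ} {φ : Fml} : IsSigma (n + 1) φ → IsSigma (n + 1) (.ex x φ)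
  /-- `Πₙ` formulas of the first-order arithmetic hierarchy. -/
  inductive IsPi : ℕ → Fml → Prop
    | delta0 {n : ℕ} {φ : Fml} : Delta0 φ → IsPi n φ
    | ofSigma {n : ℕ} {φ : Fml} : IsSigma n φ → IsPi (n + 1) φ
    | all (x : ℕ) {n : ℕ} {φ : Fml} : IsPi (n + 1) φ → IsPi (n + 1) (.all x φ)
end

/-- `Σ₀(Σₙ)`: the closure of `Σₙ` under Boolean operations and bounded
quantification. -/
inductive Sigma0Sigma (n : ℕ) : Fml → Prop
  | ofSigma {φ : Fml} : IsSigma n φ → Sigma0Sigma n φ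
  | not {φ : Fml} : Sigma0Sigma n φ → Sigma0Sigma n (.not φ)
  | and {φ ψ : Fml} : Sigma0Sigma n φ → Sigma0Sigma n ψ → Sigma0Sigma n (.and φ ψ)
  | or {φ ψ : Fml} : Sigma0Sigma n φ → Sigma0Sigma n ψ → Sigma0Sigma n (.or φ ψ)
  | imp {φ ψ : Fml} : Sigma0Sigma n φ → Sigma0Sigma n ψ → Sigma0Sigma n (.imp φ ψ)
  | ball (x : ℕ) (t : Term) {φ : Fml} : Sigma0Sigma n φ → Sigma0Sigma n (.ball x t φ)
  | bex (x : ℕ) (t : Term) {φ : Fml} : Sigma0Sigma n φ → Sigma0Sigma n (.bex x t φ)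

/-- The class `Σₙ ∧ Πₙ` of conjunctions of a `Σₙ` and a `Πₙ` formula. -/
def SigmaAndPi (n : ℕ) (φ : Fml) : Prop :=
  ∃ ψ χ : Fml, IsSigma n ψ ∧ IsPi n χ ∧ φ = Fml.and ψ χ

/-- The class `Σₙ ∨ Πₙ` of disjunctions of a `Σₙ` and a `Πₙ` formula. -/
def SigmaOrPi (n : ℕ) (φ : Fml) : Prop :=
  ∃ ψ χ : Fml, IsSigma n ψ ∧ IsPi n χ ∧ φ = Fml.or ψ χ

/-- `Δ₀⁰` formulas of second-order arithmetic: only bounded first-order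
quantifiers; free set variables (set parameters) are allowed. -/
inductive Delta0SO : Fml → Prop
  | eq (t u : Term) : Delta0SO (.eq t u)
  | lt (t u : Term) : Delta0SO (.lt t u)
  | mem (t : Term) (i : ℕ) : Delta0SO (.mem t i)
  | not {φ : Fml} : Delta0SO φ → Delta0SO (.not φ)
  | and {φ ψ : Fml} : Delta0SO φ → Delta0SO ψ → Delta0SO (.and φ ψ)
  | or {φ ψ : Fml} : Delta0SO φ → Delta0SO ψ → Delta0SO (.or φ ψ)
  | imp {φ ψ : Fml} : Delta0SO φ → Delta0SO ψ → Delta0SO (.imp φ ψ)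
  | ball (x : ℕ) (t : Term) {φ : Fml} : Delta0SO φ → Delta0SO (.ball x t φ)
  | bex (x : ℕ) (t : Term) {φ : Fml} : Delta0SO φ → Delta0SO (.bex x t φ)

mutual
  /-- `Σₙ⁰` formulas of the second-order arithmetic hierarchy
  (set parameters allowed, no set quantifiers). -/
  inductive SigmaSO : ℕ → Fml → Prop
    | delta0 {n : ℕ} {φ : Fml} : Delta0SO φ → SigmaSO n φ
    | ofPi {n : ℕ} {φ : Fml} : PiSO n φ → SigmaSO (n + 1) φ
    | ex (x : ℕ) {n : ℕ} {φ : Fml} : SigmaSO (n + 1) φ → SigmaSO (n + 1) (.ex x φ)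
  /-- `Πₙ⁰` formulas of the second-order arithmetic hierarchy. -/
  inductive PiSO : ℕ → Fml → Prop
    | delta0 {n : ℕ} {φ : Fml} : Delta0SO φ → PiSO n φ
    | ofSigma {n : ℕ} {φ : Fml} : SigmaSO n φ → PiSO (n + 1) φ
    | all (x : ℕ) {n : ℕ} {φ : Fml} : PiSO (n + 1) φ → PiSO (n + 1) (.all x φ)
end

/-! ## First-order theories -/

/-- `PA⁻`: the theory of non-negative parts of discretely ordered rings. -/
structure PAminus (S : Str) : Prop where
  add_assoc : ∀ a b c, S.add (S.add a b) c = S.add a (S.add b c)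
  add_comm : ∀ a b, S.add a b = S.add b a
  mul_assoc : ∀ a b c, S.mul (S.mul a b) c = S.mul a (S.mul b c)
  mul_comm : ∀ a b, S.mul a b = S.mul b a
  distrib : ∀ a b c, S.mul a (S.add b c) = S.add (S.mul a b) (S.mul a c)
  add_zero : ∀ a, S.add a S.zero = a
  mul_zero : ∀ a, S.mul a S.zero = S.zero
  mul_one : ∀ a, S.mul a S.one = a
  lt_irrefl : ∀ a, ¬ S.lt a a
  lt_trans : ∀ a b c, S.lt a b → S.lt b c → S.lt a c
  lt_total : ∀ a b, S.lt a b ∨ a = b ∨ S.lt b a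
  add_lt_add : ∀ a b c, S.lt a b → S.lt (S.add a c) (S.add b c)
  mul_lt_mul : ∀ a b c, S.lt a b → S.lt S.zero c → S.lt (S.mul a c) (S.mul b c)
  zero_lt_one : S.lt S.zero S.one
  zero_le : ∀ a, a = S.zero ∨ S.lt S.zero a
  discrete : ∀ a b, S.lt a b → S.add a S.one = b ∨ S.lt (S.add a S.one) b
  pred : ∀ a, S.lt S.zero a → ∃ b, S.add b S.one = a
  sub : ∀ a b, S.lt a b → ∃ c, S.add a c = b

/-- The induction scheme for the class `Γ` of formulas
(parameters are allowed via the ambient valuation `v`). -/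
def IndFor (S : Str) (Γ : Fml → Prop) : Prop :=
  ∀ φ : Fml, Γ φ → ∀ (v : ℕ → S.M) (x : ℕ),
    Sat0 S (upd v x S.zero) φ →
    (∀ m, Sat0 S (upd v x m) φ → Sat0 S (upd v x (S.add m S.one)) φ) →
    ∀ m, Sat0 S (upd v x m) φ

/-- The collection scheme for the class `Γ`:
`(∀ x < a ∃ y φ) → (∃ b ∀ x < a ∃ y < b φ)`. -/
def CollFor (S : Str) (Γ : Fml → Prop) : Prop :=
  ∀ φ : Fml, Γ φ → ∀ (v : ℕ → S.M) (x y : ℕ), x ≠ y → ∀ a : S.M,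
    (∀ m, S.lt m a → ∃ k, Sat0 S (upd (upd v x m) y k) φ) →
    ∃ b, ∀ m, S.lt m a → ∃ k, S.lt k b ∧ Sat0 S (upd (upd v x m) y k) φ

/-- `IΔ₀` (over `PA⁻`). -/
def IDelta0 (S : Str) : Prop := PAminus S ∧ IndFor S Delta0

/-- `IΣₙ` (over `PA⁻`; note `Δ₀ ⊆ Σₙ`, so this includes `IΔ₀`). -/
def ISigma (S : Str) (n : ℕ) : Prop := PAminus S ∧ IndFor S (IsSigma n)

/-- `BΣₙ`: the `Σₙ`-collection scheme, including `IΔ₀` (over `PA⁻`). -/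
def BSigma (S : Str) (n : ℕ) : Prop := IDelta0 S ∧ CollFor S (IsSigma n)

/-- The weak regularity principle `WRφ` for all `φ` in the class `Γ`:
the universal closure of `(∀ x ∃ y < a φ(x,y)) → (∃ y < a ∀ b ∃ x > b φ(x,y))`.
Here `x, y` are the two displayed variables and all other free variables of
`φ` are parameters, interpreted by the ambient valuation `v`. -/
def WRFor (S : Str) (Γ : Fml → Prop) : Prop :=
  ∀ φ : Fml, Γ φ → ∀ (v : ℕ → S.M) (x y : ℕ), x ≠ y → ∀ a : S.M,
    (∀ m, ∃ k, S.lt k a ∧ Sat0 S (upd (upd v x m) y k) φ) →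
    ∃ k, S.lt k a ∧ ∀ b, ∃ m, S.lt b m ∧ Sat0 S (upd (upd v x m) y k) φ

/-! ## Second-order theories -/

/-- Second-order induction scheme for the class `Γ`, with set parameters
from the second-order universe `X`. -/
def IndForSO (S : Str) (X : Set (Set S.M)) (Γ : Fml → Prop) : Prop :=
  ∀ φ : Fml, Γ φ → ∀ (v : ℕ → S.M) (w : ℕ → Set S.M), (∀ i, w i ∈ X) → ∀ x : ℕ,
    Sat S X (upd v x S.zero) w φ →
    (∀ m, Sat S X (upd v x m) w φ → Sat S X (upd v x (S.add m S.one)) w φ) →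
    ∀ m, Sat S X (upd v x m) w φ

/-- Second-order collection scheme for the class `Γ`. -/
def CollForSO (S : Str) (X : Set (Set S.M)) (Γ : Fml → Prop) : Prop :=
  ∀ φ : Fml, Γ φ → ∀ (v : ℕ → S.M) (w : ℕ → Set S.M), (∀ i, w i ∈ X) →
    ∀ (x y : ℕ), x ≠ y → ∀ a : S.M,
    (∀ m, S.lt m a → ∃ k, Sat S X (upd (upd v x m) y k) w φ) →
    ∃ b, ∀ m, S.lt m a → ∃ k, S.lt k b ∧ Sat S X (upd (upd v x m) y k) w φ

/-- `Δ₁⁰`-comprehension. -/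
def Delta1CA (S : Str) (X : Set (Set S.M)) : Prop :=
  ∀ φ ψ : Fml, SigmaSO 1 φ → PiSO 1 ψ →
    ∀ (v : ℕ → S.M) (w : ℕ → Set S.M), (∀ i, w i ∈ X) → ∀ x : ℕ,
    (∀ m, Sat S X (upd v x m) w φ ↔ Sat S X (upd v x m) w ψ) →
    ∃ A ∈ X, ∀ m, m ∈ A ↔ Sat S X (upd v x m) w φ

/-- `Σₙ`-comprehension for first-order formulas with parameters from `M`. -/
def SigmaCA (S : Str) (X : Set (Set S.M)) (n : ℕ) : Prop :=
  ∀ φ : Fml, IsSigma n φ → ∀ (v : ℕ → S.M) (x : ℕ),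
    ∃ A ∈ X, ∀ m, m ∈ A ↔ Sat0 S (upd v x m) φ

/-- `RCA₀`. -/
def RCA0 (S : Str) (X : Set (Set S.M)) : Prop :=
  PAminus S ∧ IndForSO S X (SigmaSO 1) ∧ Delta1CA S X

/-- `Σ₁⁰`-separation; over `RCA₀` this is equivalent to weak Kőnig's lemma. -/
def Sigma1Sep (S : Str) (X : Set (Set S.M)) : Prop :=
  ∀ φ ψ : Fml, SigmaSO 1 φ → SigmaSO 1 ψ →
    ∀ (v : ℕ → S.M) (w : ℕ → Set S.M), (∀ i, w i ∈ X) → ∀ x : ℕ,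
    (∀ m, ¬ (Sat S X (upd v x m) w φ ∧ Sat S X (upd v x m) w ψ)) →
    ∃ A ∈ X, ∀ m, (Sat S X (upd v x m) w φ → m ∈ A) ∧ (m ∈ A → ¬ Sat S X (upd v x m) w ψ)

/-- `WKL₀`, rendered as `RCA₀` plus `Σ₁⁰`-separation (which is equivalent,
over `RCA₀`, to weak Kőnig's lemma). -/
def WKL0 (S : Str) (X : Set (Set S.M)) : Prop := RCA0 S X ∧ Sigma1Sep S X

/-- `BΣₙ⁰`: the second-order `Σₙ⁰`-collection scheme (including `IΔ₀⁰`,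
over `PA⁻`). -/
def BSigmaSO (S : Str) (X : Set (Set S.M)) (n : ℕ) : Prop :=
  PAminus S ∧ IndForSO S X Delta0SO ∧ CollForSO S X (SigmaSO n)

/-- `IΣₙ⁰`: the second-order `Σₙ⁰`-induction scheme, over `RCA₀`. -/
def ISigmaSO (S : Str) (X : Set (Set S.M)) (n : ℕ) : Prop :=
  RCA0 S X ∧ IndForSO S X (SigmaSO n)

/-! ## Exponentiation and binary digits -/

/-- Satisfaction of a three-variable formula `E(x₀, x₁, x₂)` at `(a, b, c)`. -/
def ExpAt (S : Str) (E : Fml) (a b c : S.M) : Prop :=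
  Sat0 S (fun i => if i = 0 then a else if i = 1 then b else c) E

/-- `E(x₀,x₁,x₂)` is a `Δ₀` definition of the (total) exponentiation function
`x₀ ^ x₁ = x₂`.  The existence of such an `E` expresses `exp`
(the totality of exponentiation). -/
structure IsExpDef (S : Str) (E : Fml) : Prop where
  delta0 : Delta0 E
  base : ∀ a, ExpAt S E a S.zero S.one
  total : ∀ a b, ∃ c, ExpAt S E a b c
  unique : ∀ a b c c', ExpAt S E a b c → ExpAt S E a b c' → c = c'
  step : ∀ a b c, ExpAt S E a b c → ExpAt S E a (S.add b S.one) (S.mul c a)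

/-- `exp`: the totality of exponentiation (via a `Δ₀` definition of its
graph). -/
def SatExp (S : Str) : Prop := ∃ E : Fml, IsExpDef S E

/-! ## Embeddings, end extensions and elementarity -/

/-- An embedding of arithmetic structures. -/
structure Emb (S K : Str) where
  j : S.M → K.M
  inj : Function.Injective j
  zero : j S.zero = K.zero
  one : j S.one = K.one
  add : ∀ a b, j (S.add a b) = K.add (j a) (j b)
  mul : ∀ a b, j (S.mul a b) = K.mul (j a) (j b)
  lt_iff : ∀ a b, S.lt a b ↔ K.lt (j a) (j b)

/-- The extension along `e` is an end extension: every element of `K` not in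
the image of `M` exceeds every element of `M`. -/
def IsEndExt {S K : Str} (e : Emb S K) : Prop :=
  ∀ b : K.M, b ∉ Set.range e.j → ∀ a : S.M, K.lt (e.j a) b

/-- The extension along `e` is proper. -/
def IsProper {S K : Str} (e : Emb S K) : Prop := ¬ Function.Surjective e.j

/-- The extension along `e` is `Σₙ`-elementary: all `Σₙ` formulas with
parameters from `M` are absolute between `M` and `K`. -/
def SigmaElem {S K : Str} (e : Emb S K) (n : ℕ) : Prop :=
  ∀ φ : Fml, IsSigma n φ → ∀ v : ℕ → S.M,
    (Sat0 S v φ ↔ Sat0 K (fun i => e.j (v i)) φ)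

/-- `K ⊨ M‑IΣₙ` (for an extension `e : M → K`): induction up to any `a ∈ M`
for `Σₙ` formulas with parameters from `K`. -/
def MISigma {S K : Str} (e : Emb S K) (n : ℕ) : Prop :=
  ∀ φ : Fml, IsSigma n φ → ∀ (v : ℕ → K.M) (x : ℕ) (a : S.M),
    Sat0 K (upd v x K.zero) φ →
    (∀ m, K.lt m (e.j a) → (Sat0 K (upd v x m) φ → Sat0 K (upd v x (K.add m K.one)) φ)) →
    ∀ m, K.lt m (e.j a) → Sat0 K (upd v x m) φ

/-- The `x`-th binary digit of `c ∈ K` is `1`, computed via a `Δ₀` definition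
`E` of exponentiation on the ground model `S` (here `x` lies under the image
of `S`): there are `x', p ∈ M` with `j x' = x`, `p = 2 ^ x'`, and `u, v ∈ K`
with `c = u·(2p) + p + v` and `v < p`. -/
def BitVia {S K : Str} (e : Emb S K) (E : Fml) (x c : K.M) : Prop :=
  ∃ x' p : S.M, e.j x' = x ∧ ExpAt S E (S.add S.one S.one) x' p ∧
    ∃ u v : K.M, K.lt v (e.j p) ∧
      c = K.add (K.add (K.mul u (K.add (e.j p) (e.j p))) (e.j p)) v

/-! ## The second-order restricted ultrapower -/

/-- `A` is cofinal (unbounded) in `S`. -/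
def Cofinal (S : Str) (A : Set S.M) : Prop := ∀ b : S.M, ∃ x ∈ A, S.lt b x

/-- The pairing term `⟨x, y⟩ = (x + y)·(x + y) + x`. -/
def pairS (S : Str) (x y : S.M) : S.M := S.add (S.mul (S.add x y) (S.add x y)) x

/-- The graph of `f : M → M`, coded as a subset of `M` via pairing. -/
def graphOf (S : Str) (f : S.M → S.M) : Set S.M := {m | ∃ x, m = pairS S x (f x)}

/-- `f` is a total function `M → M` lying in the second-order universe `X`
(its coded graph belongs to `X`).  The collection of such `f` is the class
`ℱ` of the restricted ultrapower. -/
def FuncIn (S : Str) (X : Set (Set S.M)) (f : S.M → S.M) : Prop := graphOf S f ∈ X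

/-- `U` is an ultrafilter on the Boolean algebra `X`, all of whose elements
are cofinal in `M`. -/
structure UltraOn (S : Str) (X U : Set (Set S.M)) : Prop where
  subset : U ⊆ X
  univ_mem : Set.univ ∈ U
  empty_not_mem : ∅ ∉ U
  inter_mem : ∀ A ∈ U, ∀ B ∈ U, A ∩ B ∈ U
  superset_mem : ∀ A ∈ U, ∀ B ∈ X, A ⊆ B → B ∈ U
  ultra : ∀ A ∈ X, A ∈ U ∨ Aᶜ ∈ U
  cofinal : ∀ A ∈ U, Cofinal S A

/-- A realization of the second-order restricted ultrapower `ℱ/𝒰` of `S`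
with respect to the second-order universe `X` and the ultrafilter `U`:
a structure `K` whose elements are exactly the classes `cls f hf = [f]` of
total functions `f ∈ ℱ`, where `[f] = [g]` iff `f = g` on a set in `U`, with
pointwise arithmetic operations, order decided by `U`, and the inherited
second-order membership relation `memK` serving as the second-order expansion. -/
structure RUP (S : Str) (X U : Set (Set S.M)) : Type 1 where
  K : Str
  cls : (f : S.M → S.M) → FuncIn S X f → K.M
  memK : K.M → Set S.M → Prop
  const_in : ∀ a : S.M, FuncIn S X (fun _ => a)
  surj : ∀ b : K.M, ∃ (f : S.M → S.M) (hf : FuncIn S X f), cls f hf = b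
  eq_iff : ∀ (f : S.M → S.M) (hf : FuncIn S X f) (g : S.M → S.M) (hg : FuncIn S X g),
      (cls f hf = cls g hg) ↔ {i : S.M | f i = g i} ∈ U
  lt_iff : ∀ (f : S.M → S.M) (hf : FuncIn S X f) (g : S.M → S.M) (hg : FuncIn S X g),
      K.lt (cls f hf) (cls g hg) ↔ {i : S.M | S.lt (f i) (g i)} ∈ U
  zero_eq : K.zero = cls (fun _ => S.zero) (const_in S.zero)
  one_eq : K.one = cls (fun _ => S.one) (const_in S.one)
  add_eq : ∀ (f : S.M → S.M) (hf : FuncIn S X f) (g : S.M → S.M) (hg : FuncIn S X g)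
      (h : S.M → S.M) (hh : FuncIn S X h), (∀ i, h i = S.add (f i) (g i)) →
      K.add (cls f hf) (cls g hg) = cls h hh
  mul_eq : ∀ (f : S.M → S.M) (hf : FuncIn S X f) (g : S.M → S.M) (hg : FuncIn S X g)
      (h : S.M → S.M) (hh : FuncIn S X h), (∀ i, h i = S.mul (f i) (g i)) →
      K.mul (cls f hf) (cls g hg) = cls h hh
  mem_iff : ∀ (f : S.M → S.M) (hf : FuncIn S X f) (A : Set S.M), A ∈ X →
      (memK (cls f hf) A ↔ {i : S.M | f i ∈ A} ∈ U)

/-- The canonical embedding `M → ℱ/𝒰` via constant functions. -/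
def RUP.emb {S : Str} {X U : Set (Set S.M)} (R : RUP S X U) (a : S.M) : R.K.M :=
  R.cls (fun _ => a) (R.const_in a)

/-- The subset of `ℱ/𝒰` induced by `A ⊆ M`. -/
def RUP.setImg {S : Str} {X U : Set (Set S.M)} (R : RUP S X U) (A : Set S.M) :
    Set R.K.M := {b | R.memK b A}

/-- The second-order part of the expanded ultrapower `(ℱ/𝒰, 𝒳)`:
the (injected) copy of `X`. -/
def RUP.X2 {S : Str} {X U : Set (Set S.M)} (R : RUP S X U) : Set (Set R.K.M) :=
  (fun A => R.setImg A) '' X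

end PaperArith

namespace PaperArith

section Algebra

instance (S : Str) : Zero S.M := ⟨S.zero⟩

instance (S : Str) : One S.M := ⟨S.one⟩

instance (S : Str) : Add S.M := ⟨S.add⟩

instance (S : Str) : Mul S.M := ⟨S.mul⟩

noncomputable instance instCommSemiringStr (S : Str) [h : Fact (PAminus S)] :
    CommSemiring S.M where
  add_assoc := h.out.add_assoc
  add_comm := h.out.add_comm
  zero_add a := (h.out.add_comm _ _).trans (h.out.add_zero a)
  add_zero := h.out.add_zero
  mul_assoc := h.out.mul_assoc
  mul_comm := h.out.mul_comm
  one_mul a := (h.out.mul_comm _ _).trans (h.out.mul_one a)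
  mul_one := h.out.mul_one
  zero_mul a := (h.out.mul_comm _ _).trans (h.out.mul_zero a)
  mul_zero := h.out.mul_zero
  left_distrib := h.out.distrib
  right_distrib a b c := by
    change S.mul (S.add a b) c = S.add (S.mul a c) (S.mul b c)
    rw [h.out.mul_comm, h.out.distrib, h.out.mul_comm c a, h.out.mul_comm c b]
  nsmul := nsmulRec

noncomputable instance instLinearOrderStr (S : Str) [h : Fact (PAminus S)] :
    LinearOrder S.M where
  le a b := a = b ∨ S.lt a b
  lt := S.lt
  le_refl a := Or.inl rfl
  le_trans a b c := by
    rintro (rfl | h1) (rfl | h2)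
    · exact Or.inl rfl
    · exact Or.inr h2
    · exact Or.inr h1
    · exact Or.inr (h.out.lt_trans _ _ _ h1 h2)
  lt_iff_le_not_ge a b := by
    constructor
    · intro hab
      refine ⟨Or.inr hab, ?_⟩
      rintro (rfl | hba)
      · exact h.out.lt_irrefl _ hab
      · exact h.out.lt_irrefl _ (h.out.lt_trans _ _ _ hab hba)
    · rintro ⟨rfl | hab, hn⟩
      · exact absurd (Or.inl rfl) hn
      · exact hab
  le_antisymm a b := by
    rintro (rfl | h1) (h2 | h2)
    · rfl
    · rfl
    · exact h2.symm
    · exact absurd (h.out.lt_trans _ _ _ h1 h2) (h.out.lt_irrefl _)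
  le_total a b := by
    rcases h.out.lt_total a b with h1 | h1 | h1
    · exact Or.inl (Or.inr h1)
    · exact Or.inl (Or.inl h1)
    · exact Or.inr (Or.inr h1)
  toDecidableLE := Classical.decRel _

instance instIsStrictOrderedRingStr (S : Str) [h : Fact (PAminus S)] :
    IsStrictOrderedRing S.M :=
  have hadd : ∀ a b c : S.M, a < b → a + c < b + c := h.out.add_lt_add
  have hmul : ∀ a b c : S.M, a < b → 0 < c → a * c < b * c := h.out.mul_lt_mul
  { add_le_add_left := fun a b hab c => by
      rcases hab.eq_or_lt with rfl | hab
      · exact le_rfl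
      · exact (hadd a b c hab).le
    le_of_add_le_add_left := fun a b c hab => by
      by_contra hn
      have := hadd c b a (not_le.mp hn)
      rw [add_comm c, add_comm b] at this
      exact absurd hab (not_le.mpr this)
    zero_le_one := le_of_lt h.out.zero_lt_one
    exists_pair_ne := ⟨0, 1, ne_of_lt h.out.zero_lt_one⟩
    mul_lt_mul_of_pos_left := fun a ha b c hbc => by
      rw [mul_comm a b, mul_comm a c]
      exact hmul b c a hbc ha
    mul_lt_mul_of_pos_right := fun a ha b c hbc => hmul b c a hbc ha }

instance instCanonicallyOrderedAddStr (S : Str) [h : Fact (PAminus S)] :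
    CanonicallyOrderedAdd S.M :=
  have hpos : ∀ a : S.M, 0 ≤ a := fun a => by
    rcases h.out.zero_le a with h1 | h1
    · exact Or.inl h1.symm
    · exact Or.inr h1
  { exists_add_of_le := fun {a b} hab => by
      rcases hab with rfl | hab
      · exact ⟨0, (add_zero _).symm⟩
      · obtain ⟨c, hc⟩ := h.out.sub a b hab
        exact ⟨c, hc.symm⟩
    le_self_add := fun a b => le_add_of_nonneg_right (hpos b)
    le_add_self := fun a b => le_add_of_nonneg_left (hpos b) }

theorem add_one_le_of_lt_str (S : Str) [h : Fact (PAminus S)] {a b : S.M} (hab : a < b) :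
    a + 1 ≤ b :=
  h.out.discrete a b hab

theorem lt_add_one_iff_str (S : Str) [h : Fact (PAminus S)] {a b : S.M} :
    a < b + 1 ↔ a ≤ b := by
  constructor
  · intro hab
    by_contra hn
    exact absurd (add_one_le_of_lt_str S (not_le.mp hn)) (not_le.mpr hab)
  · intro hab
    exact lt_of_le_of_lt hab (lt_add_one b)

variable {S : Str} [h : Fact (PAminus S)]

/-- The binary digit of `c` at the place of value `p` is `1`. -/
def DigitOne (p c : S.M) : Prop := ∃ u r : S.M, r < p ∧ c = u * (p + p) + p + r

theorem quotient_le_of_divMod {d u r u' r' : S.M} (hr : r < d)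
    (hle : u' * d + r' ≤ u * d + r) : u' ≤ u := by
  by_contra hn
  have h1 := add_one_le_of_lt_str S (not_le.mp hn)
  have h2 : (u + 1) * d ≤ u' * d := mul_le_mul_left h1 d
  have h3 : u' * d ≤ u' * d + r' := le_self_add
  have h4 : u * d + r < u * d + d := add_lt_add_right hr _
  have h5 : (u + 1) * d = u * d + d := by ring
  rw [h5] at h2
  exact absurd (h2.trans (h3.trans hle)) (not_le.mpr h4)

theorem remainder_unique {d u r u' r' : S.M} (hr : r < d) (hr' : r' < d)
    (heq : u * d + r = u' * d + r') : r = r' := by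
  have h1 : u = u' :=
    le_antisymm (quotient_le_of_divMod hr' heq.le) (quotient_le_of_divMod hr heq.ge)
  subst h1
  exact add_left_cancel heq

theorem digitOne_of_divMod {p c u r : S.M} (hc : c = u * (p + p) + r) (hp : p ≤ r)
    (hr : r < p + p) : DigitOne p c := by
  obtain ⟨s, rfl⟩ := exists_add_of_le hp
  refine ⟨u, s, lt_of_add_lt_add_left hr, ?_⟩
  rw [hc, add_assoc]

theorem not_digitOne_zero {p : S.M} (hp : 0 < p) : ¬ DigitOne p 0 := by
  rintro ⟨u, r, -, h0⟩
  have h1 : p ≤ u * (p + p) + p + r := le_add_right le_add_self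
  rw [← h0] at h1
  exact absurd hp (not_lt.mpr h1)

theorem digitOne_of_add_larger
    (hdiv : ∀ c d : S.M, 0 < d → ∃ u r, r < d ∧ c = u * d + r)
    {p p' w c : S.M} (hp' : 0 < p') (hw : p = w * (p' + p')) (hd : DigitOne p' (c + p)) :
    DigitOne p' c := by
  obtain ⟨U, V, hV, hUV⟩ := hd
  obtain ⟨u, r, hr, hc⟩ := hdiv c (p' + p') (add_pos hp' hp')
  have h1 : (u + w) * (p' + p') + r = U * (p' + p') + (p' + V) := by
    rw [← add_assoc, ← hUV, hc, hw]; ring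
  have h2 : r = p' + V := remainder_unique hr (add_lt_add_right hV _) h1
  exact ⟨u, V, hV, by rw [hc, h2, add_assoc]⟩

theorem digitOne_of_add_smaller
    (hdiv : ∀ c d : S.M, 0 < d → ∃ u r, r < d ∧ c = u * d + r)
    {p p' w c u r : S.M} (hp : 0 < p) (hw : p' = w * (p + p))
    (hc : c = u * (p + p) + r) (hr : r < p) (hd : DigitOne p' (c + p)) :
    DigitOne p' c := by
  obtain ⟨U, V, hV, hUV⟩ := hd
  obtain ⟨z, s, hs, hVs⟩ := hdiv V (p + p) (add_pos hp hp)
  have h1 : u * (p + p) + (p + r) = (U * (w + w) + w + z) * (p + p) + s := by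
    have : u * (p + p) + (p + r) = c + p := by rw [hc]; ring
    rw [this, hUV, hVs, hw]; ring
  have h2 : p + r = s := remainder_unique (add_lt_add_right hr _) hs h1
  have hV' : V = (z * (p + p) + r) + p := by rw [hVs, ← h2]; ring
  refine ⟨U, z * (p + p) + r, lt_of_le_of_lt ?_ hV, ?_⟩
  · rw [hV']; exact le_self_add
  · apply add_right_cancel (b := p)
    rw [hUV, hV']; ring

theorem add_lt_of_not_digitOne {p q w c u r : S.M} (hw : q = w * (p + p))
    (hc : c = u * (p + p) + r) (hr : r < p) (hcq : c < q) : c + p < q := by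
  have h1 : u < w := by
    by_contra hn
    have h2 : w * (p + p) ≤ u * (p + p) := mul_le_mul_left (not_lt.mp hn) _
    rw [← hw] at h2
    have h3 : u * (p + p) ≤ c := by rw [hc]; exact le_self_add
    exact absurd (h2.trans h3) (not_le.mpr hcq)
  have h2 : (u + 1) * (p + p) ≤ w * (p + p) :=
    mul_le_mul_left (add_one_le_of_lt_str S h1) _
  rw [hw]
  refine lt_of_lt_of_le ?_ h2
  have h3 : c + p = u * (p + p) + p + r := by rw [hc]; ring
  have h4 : (u + 1) * (p + p) = u * (p + p) + p + p := by ring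
  rw [h3, h4]
  exact add_lt_add_right hr _

end Algebra

section Definability

variable (K : Str)

/-- Prepend an element to a valuation (de Bruijn style). -/
def cns {α : Type} (m : α) (v : ℕ → α) : ℕ → α
  | 0 => m
  | i + 1 => v i

/-- `f` is the value of a term, as a function of the valuation. -/
def IsT (f : (ℕ → K.M) → K.M) : Prop := ∃ t : Term, ∀ v, f v = tval K v t

/-- Predicates on valuations that are definable by a bounded formula. -/
inductive D0 : ((ℕ → K.M) → Prop) → Prop
  | eq {f g : (ℕ → K.M) → K.M} : IsT K f → IsT K g → D0 (fun v => f v = g v)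
  | lt {f g : (ℕ → K.M) → K.M} : IsT K f → IsT K g → D0 (fun v => K.lt (f v) (g v))
  | not {P : (ℕ → K.M) → Prop} : D0 P → D0 (fun v => ¬ P v)
  | and {P Q : (ℕ → K.M) → Prop} : D0 P → D0 Q → D0 (fun v => P v ∧ Q v)
  | ball {f : (ℕ → K.M) → K.M} {P : (ℕ → K.M) → Prop} : IsT K f → D0 P →
      D0 (fun v => ∀ m, K.lt m (f v) → P (cns m v))

/-- Predicates on valuations that are definable by a `Σₙ` formula whose unbounded quantifier
blocks have length one. -/
def Sg : ℕ → ((ℕ → K.M) → Prop) → Prop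
  | 0, P => D0 K P
  | n + 1, P => ∃ Q, Sg n Q ∧ ∀ v, P v ↔ ∃ y, ¬ Q (cns y v)

/-- Predicates whose negation is in `Sg`. -/
def Pg (n : ℕ) (P : (ℕ → K.M) → Prop) : Prop := Sg K n (fun v => ¬ P v)

variable {K}

theorem IsT.var (i : ℕ) : IsT K (fun v => v i) := ⟨.var i, fun _ => rfl⟩

theorem IsT.zero : IsT K (fun _ => K.zero) := ⟨.zero, fun _ => rfl⟩

theorem IsT.one : IsT K (fun _ => K.one) := ⟨.one, fun _ => rfl⟩

theorem IsT.add {f g : (ℕ → K.M) → K.M} (hf : IsT K f) (hg : IsT K g) :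
    IsT K (fun v => K.add (f v) (g v)) := by
  obtain ⟨t, ht⟩ := hf
  obtain ⟨u, hu⟩ := hg
  exact ⟨.add t u, fun v => by simp only [ht, hu]; rfl⟩

theorem IsT.mul {f g : (ℕ → K.M) → K.M} (hf : IsT K f) (hg : IsT K g) :
    IsT K (fun v => K.mul (f v) (g v)) := by
  obtain ⟨t, ht⟩ := hf
  obtain ⟨u, hu⟩ := hg
  exact ⟨.mul t u, fun v => by simp only [ht, hu]; rfl⟩

theorem IsT.subst {f : (ℕ → K.M) → K.M} (hf : IsT K f) {s : (ℕ → K.M) → ℕ → K.M}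
    (hs : ∀ i, IsT K (fun v => s v i)) : IsT K (fun v => f (s v)) := by
  obtain ⟨t, ht⟩ := hf
  simp only [ht]
  clear ht
  induction t with
  | var i => exact hs i
  | zero => exact IsT.zero
  | one => exact IsT.one
  | add t u iht ihu => exact iht.add ihu
  | mul t u iht ihu => exact iht.mul ihu

theorem isT_cns {f : (ℕ → K.M) → K.M} {s : (ℕ → K.M) → ℕ → K.M} (hf : IsT K f)
    (hs : ∀ i, IsT K (fun v => s v i)) : ∀ i, IsT K (fun v => cns (f v) (s v) i)
  | 0 => hf
  | i + 1 => hs i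

theorem isT_lift {s : (ℕ → K.M) → ℕ → K.M} (hs : ∀ i, IsT K (fun v => s v i)) :
    ∀ i, IsT K (fun w => cns (w 0) (s (fun j => w (j + 1))) i) :=
  isT_cns (IsT.var 0) fun i => (hs i).subst fun j => IsT.var (j + 1)

theorem D0.subst {P : (ℕ → K.M) → Prop} (hP : D0 K P) :
    ∀ {s : (ℕ → K.M) → ℕ → K.M}, (∀ i, IsT K (fun v => s v i)) →
      D0 K (fun v => P (s v)) := by
  induction hP with
  | eq hf hg => exact fun hs => .eq (hf.subst hs) (hg.subst hs)
  | lt hf hg => exact fun hs => .lt (hf.subst hs) (hg.subst hs)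
  | not _ ih => exact fun hs => .not (ih hs)
  | and _ _ ih1 ih2 => exact fun hs => .and (ih1 hs) (ih2 hs)
  | ball hf _ ih => exact fun hs => .ball (hf.subst hs) (ih (isT_lift hs))

theorem D0.or {P Q : (ℕ → K.M) → Prop} (hP : D0 K P) (hQ : D0 K Q) :
    D0 K (fun v => P v ∨ Q v) := by
  have := (hP.not.and hQ.not).not
  convert this using 2
  tauto

theorem D0.imp {P Q : (ℕ → K.M) → Prop} (hP : D0 K P) (hQ : D0 K Q) :
    D0 K (fun v => P v → Q v) := by
  have := (hP.and hQ.not).not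
  convert this using 2
  tauto

theorem D0.bex {f : (ℕ → K.M) → K.M} {P : (ℕ → K.M) → Prop} (hf : IsT K f) (hP : D0 K P) :
    D0 K (fun v => ∃ m, K.lt m (f v) ∧ P (cns m v)) := by
  have := (D0.ball hf hP.not).not
  convert this using 2
  push Not
  rfl

theorem isT_upd (x : ℕ) :
    ∀ i, IsT K (fun w => upd (fun j => w (j + 1)) x (w 0) i) := by
  intro i
  by_cases hi : i = x
  · simpa [upd, hi] using IsT.var 0
  · simpa [upd, hi] using IsT.var (i + 1)

theorem D0.of_delta0 {φ : Fml} (hφ : Delta0 φ) : D0 K (fun v => Sat0 K v φ) := by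
  induction hφ with
  | eq t u => exact .eq ⟨t, fun _ => rfl⟩ ⟨u, fun _ => rfl⟩
  | lt t u => exact .lt ⟨t, fun _ => rfl⟩ ⟨u, fun _ => rfl⟩
  | not _ ih => exact ih.not
  | and _ _ ih1 ih2 => exact ih1.and ih2
  | or _ _ ih1 ih2 => exact ih1.or ih2
  | imp _ _ ih1 ih2 => exact ih1.imp ih2
  | ball x t _ ih => exact .ball ⟨t, fun _ => rfl⟩ (ih.subst (isT_upd x))
  | bex x t _ ih => exact .bex ⟨t, fun _ => rfl⟩ (ih.subst (isT_upd x))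

theorem Sg.subst : ∀ {n : ℕ} {P : (ℕ → K.M) → Prop}, Sg K n P →
    ∀ {s : (ℕ → K.M) → ℕ → K.M}, (∀ i, IsT K (fun v => s v i)) → Sg K n (fun v => P (s v))
  | 0, _, hP, _, hs => D0.subst hP hs
  | _ + 1, _, ⟨_, hQ, hPQ⟩, s, hs => ⟨_, hQ.subst (isT_lift hs), fun v => hPQ (s v)⟩

theorem Pg.subst {n : ℕ} {P : (ℕ → K.M) → Prop} (hP : Pg K n P)
    {s : (ℕ → K.M) → ℕ → K.M} (hs : ∀ i, IsT K (fun v => s v i)) :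
    Pg K n (fun v => P (s v)) :=
  Sg.subst hP hs

theorem Sg.not {n : ℕ} {P : (ℕ → K.M) → Prop} (hP : Sg K n P) : Pg K n (fun v => ¬ P v) := by
  simpa [Pg] using hP

theorem Pg.ex {n : ℕ} {P : (ℕ → K.M) → Prop} (hP : Pg K n P) :
    Sg K (n + 1) (fun v => ∃ y, P (cns y v)) :=
  ⟨_, hP, fun v => by simp⟩

theorem Pg.succ [Nonempty K.M] {n : ℕ} {P : (ℕ → K.M) → Prop} (hP : Pg K n P) :
    Sg K (n + 1) P := by
  have := (hP.subst fun i => IsT.var (i + 1)).ex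
  simpa [cns] using this

theorem Sg.succ [Nonempty K.M] : ∀ {n : ℕ} {P : (ℕ → K.M) → Prop}, Sg K n P → Sg K (n + 1) P
  | 0, _, hP => Pg.succ (D0.not hP)
  | _ + 1, _, ⟨Q, hQ, hPQ⟩ => ⟨Q, hQ.succ, hPQ⟩

theorem Sg.mono [Nonempty K.M] {m n : ℕ} (hmn : m ≤ n) {P : (ℕ → K.M) → Prop}
    (hP : Sg K m P) : Sg K n P := by
  induction hmn with
  | refl => exact hP
  | step _ ih => exact ih.succ

theorem D0.sg [Nonempty K.M] {P : (ℕ → K.M) → Prop} (hP : D0 K P) (n : ℕ) : Sg K n P :=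
  Sg.mono (m := 0) n.zero_le hP

theorem D0.pg [Nonempty K.M] {P : (ℕ → K.M) → Prop} (hP : D0 K P) (n : ℕ) : Pg K n P :=
  hP.not.sg n

variable (K) in
/-- Closure of `Sg K n` under positive connectives and bounded quantifiers. -/
structure SgClosed (n : ℕ) : Prop where
  and {P Q : (ℕ → K.M) → Prop} : Sg K n P → Sg K n Q → Sg K n (fun v => P v ∧ Q v)
  or {P Q : (ℕ → K.M) → Prop} : Sg K n P → Sg K n Q → Sg K n (fun v => P v ∨ Q v)
  ball {f : (ℕ → K.M) → K.M} {P : (ℕ → K.M) → Prop} : IsT K f → Sg K n P →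
    Sg K n (fun v => ∀ m, K.lt m (f v) → P (cns m v))
  bex {f : (ℕ → K.M) → K.M} {P : (ℕ → K.M) → Prop} : IsT K f → Sg K n P →
    Sg K n (fun v => ∃ m, K.lt m (f v) ∧ P (cns m v))

namespace SgClosed

variable {n : ℕ} {P Q : (ℕ → K.M) → Prop}

theorem pg_and (hn : SgClosed K n) (hP : Pg K n P) (hQ : Pg K n Q) : Pg K n (fun v => P v ∧ Q v) := by
  have := hn.or hP hQ
  unfold Pg
  convert this using 2
  tauto

theorem pg_ball (hn : SgClosed K n) {f : (ℕ → K.M) → K.M} (hf : IsT K f) (hP : Pg K n P) :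
    Pg K n (fun v => ∀ m, K.lt m (f v) → P (cns m v)) := by
  have := hn.bex hf hP
  unfold Pg
  convert this using 2
  push Not
  rfl

theorem pg_bex (hn : SgClosed K n) {f : (ℕ → K.M) → K.M} (hf : IsT K f) (hP : Pg K n P) :
    Pg K n (fun v => ∃ m, K.lt m (f v) ∧ P (cns m v)) := by
  have := hn.ball hf hP
  unfold Pg
  convert this using 2
  push Not
  rfl

theorem pg_imp [Nonempty K.M] (hn : SgClosed K n) (hP : D0 K P) (hQ : Pg K n Q) : 
    Pg K n (fun v => P v → Q v) := by
  have := hn.and (hP.sg n) hQ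
  unfold Pg
  convert this using 2
  tauto

end SgClosed

end Definability

section Hierarchy

variable {K : Str}

theorem Sg.congr {n : ℕ} {P Q : (ℕ → K.M) → Prop} (hP : Sg K n P) (h : ∀ v, P v ↔ Q v) :
    Sg K n Q := by
  have : P = Q := funext fun v => propext (h v)
  exact this ▸ hP

theorem SgClosed.zero : SgClosed K 0 where
  and := D0.and
  or := D0.or
  ball := D0.ball
  bex := D0.bex

theorem SgClosed.ex [Fact (PAminus K)] {n : ℕ} (hn : SgClosed K n) {P : (ℕ → K.M) → Prop}
    (hP : Sg K (n + 1) P) : Sg K (n + 1) (fun v => ∃ x, P (cns x v)) := by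
  obtain ⟨Q, hQ, hPQ⟩ := hP
  refine (hn.pg_bex (IsT.var 0) (hn.pg_bex (IsT.var 1) (hQ.not.subst
    (isT_cns (IsT.var 0) (isT_cns (IsT.var 1) fun i => IsT.var (i + 3)))))).ex.congr ?_
  intro v
  simp only [hPQ]
  constructor
  · rintro ⟨b, x, -, y, -, h⟩
    exact ⟨x, y, h⟩
  · rintro ⟨x, y, h⟩
    have hx : x < x + y + 1 := (lt_add_one_iff_str K).mpr le_self_add
    have hy : y < x + y + 1 := (lt_add_one_iff_str K).mpr le_add_self
    exact ⟨x + y + 1, x, hx, y, hy, h⟩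

variable (K) in
/-- Induction for `Sg K n`, in the first variable. -/
def IndSg (n : ℕ) : Prop :=
  ∀ P, Sg K n P → ∀ v : ℕ → K.M, P (cns K.zero v) →
    (∀ m, P (cns m v) → P (cns (K.add m K.one) v)) → ∀ m, P (cns m v)

theorem IndSg.collection [Fact (PAminus K)] {n : ℕ} (hind : IndSg K (n + 1))
    (hn : SgClosed K n) {Q : (ℕ → K.M) → Prop} (hQ : Pg K n Q) (v : ℕ → K.M) (a : K.M)
    (h : ∀ m, K.lt m a → ∃ y, Q (cns y (cns m v))) :
    ∃ b, ∀ m, K.lt m a → ∃ y, K.lt y b ∧ Q (cns y (cns m v)) := by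
  have hsg := (hn.pg_ball (IsT.var 1) (hn.pg_imp (D0.lt (IsT.var 0) (IsT.var 3))
    (hn.pg_bex (IsT.var 1) (hQ.subst (s := fun z => cns (z 0) (cns (z 1) fun i => z (i + 5)))
      (isT_cns (IsT.var 0) (isT_cns (IsT.var 1) fun i => IsT.var (i + 5))))))).ex
  have key := hind _ hsg (cns a v) ⟨K.zero, ?_⟩ ?_ a
  · obtain ⟨b, hb⟩ := key
    exact ⟨b, fun m hm => hb m hm hm⟩
  · intro m hm
    exact absurd (show m < 0 from hm) (not_lt.mpr (zero_le))
  · rintro z ⟨b, hb⟩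
    by_cases hz : K.lt z a
    · obtain ⟨y, hy⟩ := h z hz
      refine ⟨b + (y + 1), fun m hm hma => ?_⟩
      rcases ((lt_add_one_iff_str K).mp hm : m ≤ z).eq_or_lt with rfl | hmz
      · exact ⟨y, lt_of_lt_of_le (lt_add_one y) le_add_self, hy⟩
      · obtain ⟨y', hy', hQ'⟩ := hb m hmz hma
        exact ⟨y', lt_of_lt_of_le (show y' < b from hy') le_self_add, hQ'⟩
    · refine ⟨b, fun m hm hma => ?_⟩
      rcases ((lt_add_one_iff_str K).mp hm : m ≤ z).eq_or_lt with rfl | hmz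
      · exact absurd hma hz
      · exact hb m hmz hma

theorem SgClosed.succ [Fact (PAminus K)] {n : ℕ} (hn : SgClosed K n)
    (hind : IndSg K (n + 1)) : SgClosed K (n + 1) := by
  have hand : ∀ {P Q : (ℕ → K.M) → Prop}, Sg K (n + 1) P → Sg K (n + 1) Q →
      Sg K (n + 1) (fun v => P v ∧ Q v) := by
    rintro P P' ⟨Q, hQ, hPQ⟩ ⟨Q', hQ', hPQ'⟩
    have h1 := (hn.pg_and (hQ.not.subst (isT_cns (IsT.var 1) fun i => IsT.var (i + 2)))
      (hQ'.not.subst (isT_cns (IsT.var 0) fun i => IsT.var (i + 2)))).ex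
    refine (hn.ex h1).congr fun v => ?_
    rw [hPQ, hPQ']
    constructor
    · rintro ⟨x, y, h, h'⟩
      exact ⟨⟨x, h⟩, ⟨y, h'⟩⟩
    · rintro ⟨⟨x, h⟩, ⟨y, h'⟩⟩
      exact ⟨x, y, h, h'⟩
  refine ⟨hand, ?_, ?_, ?_⟩
  · rintro P P' ⟨Q, hQ, hPQ⟩ ⟨Q', hQ', hPQ'⟩
    refine ⟨_, hn.and hQ hQ', fun v => ?_⟩
    simp only [hPQ, hPQ', ← exists_or, not_and_or]
  · rintro f P hf ⟨Q, hQ, hPQ⟩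
    refine (hn.pg_ball (hf.subst fun i => IsT.var (i + 1)) (hn.pg_bex (IsT.var 1)
      (hQ.not.subst (s := fun z => cns (z 0) (cns (z 1) fun i => z (i + 3)))
        (isT_cns (IsT.var 0) (isT_cns (IsT.var 1) fun i => IsT.var (i + 3)))))).ex.congr
      fun v => ?_
    simp only [hPQ]
    constructor
    · rintro ⟨b, hb⟩ m hm
      obtain ⟨y, -, hy⟩ := hb m hm
      exact ⟨y, hy⟩
    · exact hind.collection hn hQ.not v (f v)
  · intro f P hf hP
    exact hn.ex (hand ((D0.lt (IsT.var 0) (hf.subst fun i => IsT.var (i + 1))).sg _) hP)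

mutual

theorem sg_of_isSigma [Fact (PAminus K)] : ∀ {n : ℕ} {φ : Fml}, IsSigma n φ →
    (∀ m < n, SgClosed K m) → Sg K n (fun v => Sat0 K v φ)
  | _, _, .delta0 h, _ => (D0.of_delta0 h).sg _
  | _, _, .ofPi h, hc => (pg_of_isPi h fun m hm => hc m (hm.trans (Nat.lt_succ_self _))).succ
  | _, _, .ex x h, hc =>
    (hc _ (Nat.lt_succ_self _)).ex ((sg_of_isSigma h hc).subst (isT_upd x))

theorem pg_of_isPi [Fact (PAminus K)] : ∀ {n : ℕ} {φ : Fml}, IsPi n φ →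
    (∀ m < n, SgClosed K m) → Pg K n (fun v => Sat0 K v φ)
  | _, _, .delta0 h, _ => (D0.of_delta0 h).pg _
  | _, _, .ofSigma h, hc =>
    (sg_of_isSigma h fun m hm => hc m (hm.trans (Nat.lt_succ_self _))).not.succ
  | _, _, .all x h, hc =>
    ((hc _ (Nat.lt_succ_self _)).ex ((pg_of_isPi h hc).subst (isT_upd x))).congr
      fun _ => not_forall.symm

end

theorem infinite_compl_range_cns {ρ : ℕ → ℕ} (hρ : (Set.range ρ)ᶜ.Infinite) (z : ℕ) :
    (Set.range (cns z ρ))ᶜ.Infinite := by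
  refine (hρ.sdiff (Set.finite_singleton z)).mono ?_
  rintro i ⟨hi, hz⟩ ⟨j, rfl⟩
  cases j with
  | zero => exact hz rfl
  | succ j => exact hi ⟨j, rfl⟩

theorem upd_comp_cns {ρ : ℕ → ℕ} {z : ℕ} (hz : z ∉ Set.range ρ) (v : ℕ → K.M) (m : K.M) :
    upd v z m ∘ cns z ρ = cns m (v ∘ ρ) := by
  funext i
  cases i with
  | zero => simp [cns, upd]
  | succ i =>
    have : ρ i ≠ z := fun h => hz ⟨i, h⟩
    simp [cns, upd, this]

theorem D0.exists_fml {P : (ℕ → K.M) → Prop} (hP : D0 K P) :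
    ∀ ρ : ℕ → ℕ, (Set.range ρ)ᶜ.Infinite →
      ∃ φ, Delta0 φ ∧ ∀ v, Sat0 K v φ ↔ P (v ∘ ρ) := by
  have hT : ∀ {f : (ℕ → K.M) → K.M}, IsT K f → ∀ ρ : ℕ → ℕ,
      ∃ t, ∀ v, f (v ∘ ρ) = tval K v t :=
    fun hf ρ => hf.subst fun i => IsT.var (ρ i)
  induction hP with
  | eq hf hg =>
    intro ρ _
    obtain ⟨t, ht⟩ := hT hf ρ
    obtain ⟨u, hu⟩ := hT hg ρ
    exact ⟨_, .eq t u, fun v => by simp only [ht v, hu v]; rfl⟩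
  | lt hf hg =>
    intro ρ _
    obtain ⟨t, ht⟩ := hT hf ρ
    obtain ⟨u, hu⟩ := hT hg ρ
    exact ⟨_, .lt t u, fun v => by simp only [ht v, hu v]; rfl⟩
  | not _ ih =>
    intro ρ hρ
    obtain ⟨φ, hφ, h⟩ := ih ρ hρ
    exact ⟨_, .not hφ, fun v => not_congr (h v)⟩
  | and _ _ ih ih' =>
    intro ρ hρ
    obtain ⟨φ, hφ, h⟩ := ih ρ hρ
    obtain ⟨φ', hφ', h'⟩ := ih' ρ hρ
    exact ⟨_, .and hφ hφ', fun v => and_congr (h v) (h' v)⟩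
  | ball hf _ ih =>
    intro ρ hρ
    obtain ⟨t, ht⟩ := hT hf ρ
    obtain ⟨z, hz⟩ := hρ.nonempty
    obtain ⟨φ, hφ, h⟩ := ih _ (infinite_compl_range_cns hρ z)
    refine ⟨_, .ball z t hφ, fun v => ?_⟩
    simp only [ht v]
    refine forall₂_congr fun m _ => ?_
    rw [← upd_comp_cns hz]
    exact h _

theorem Sg.exists_fml : ∀ {n : ℕ} {P : (ℕ → K.M) → Prop}, Sg K n P →
    ∀ ρ : ℕ → ℕ, (Set.range ρ)ᶜ.Infinite →
      (∃ φ, IsSigma n φ ∧ ∀ v, Sat0 K v φ ↔ P (v ∘ ρ)) ∧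
      ∃ φ, IsPi n φ ∧ ∀ v, Sat0 K v φ ↔ ¬ P (v ∘ ρ)
  | 0, _, hP, ρ, hρ => by
    obtain ⟨φ, hφ, h⟩ := D0.exists_fml hP ρ hρ
    exact ⟨⟨φ, .delta0 hφ, h⟩, ⟨_, .delta0 hφ.not, fun v => not_congr (h v)⟩⟩
  | n + 1, P, ⟨Q, hQ, hPQ⟩, ρ, hρ => by
    obtain ⟨z, hz⟩ := hρ.nonempty
    obtain ⟨⟨φ, hφ, h⟩, ⟨ψ, hψ, h'⟩⟩ := hQ.exists_fml _ (infinite_compl_range_cns hρ z)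
    refine ⟨⟨_, .ex z (.ofPi hψ), fun v => ?_⟩, ⟨_, .all z (.ofSigma hφ), fun v => ?_⟩⟩
    · rw [hPQ]
      refine exists_congr fun m => ?_
      rw [← upd_comp_cns hz]
      exact h' _
    · rw [hPQ, not_exists]
      refine forall_congr' fun m => ?_
      rw [not_not, ← upd_comp_cns hz]
      exact h _

/-- A renaming of variables with infinitely many unused variables. -/
def dbl (i : ℕ) : ℕ := 2 * i

theorem infinite_compl_range_dbl : (Set.range dbl)ᶜ.Infinite := by
  refine Set.infinite_of_injective_forall_mem (f := fun i : ℕ => 2 * i + 1) ?_ ?_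
  · intro i j h
    simpa using h
  · rintro i ⟨j, hj⟩
    simp only [dbl] at hj
    omega

/-- A valuation agreeing with `w` along `dbl`. -/
def spread {α : Type} (w : ℕ → α) (i : ℕ) : α := w (i / 2)

theorem spread_comp_dbl {α : Type} (w : ℕ → α) : spread w ∘ dbl = w := by
  funext i
  simp [spread, dbl]

theorem upd_comp_dbl {α : Type} (w : ℕ → α) (i : ℕ) (m : α) :
    upd w (2 * i) m ∘ dbl = upd (w ∘ dbl) i m := by
  funext j
  simp [dbl, upd]

theorem upd_cns_zero {α : Type} (a m : α) (w : ℕ → α) : upd (cns a w) 0 m = cns m w := by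
  funext j
  cases j <;> simp [cns, upd]

theorem upd_cns_succ {α : Type} (a m : α) (w : ℕ → α) (i : ℕ) :
    upd (cns a w) (i + 1) m = cns a (upd w i m) := by
  funext j
  cases j <;> simp [cns, upd]

theorem upd_spread_comp_dbl {α : Type} (a m : α) (w : ℕ → α) :
    upd (spread (cns a w)) 0 m ∘ dbl = cns m w := by
  rw [upd_comp_dbl _ 0, spread_comp_dbl, upd_cns_zero]

theorem upd_upd_spread_comp_dbl {α : Type} (a b m k : α) (w : ℕ → α) :
    upd (upd (spread (cns a (cns b w))) 2 m) 0 k ∘ dbl = cns k (cns m w) := by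
  rw [upd_comp_dbl _ 0, upd_comp_dbl _ 1, spread_comp_dbl, upd_cns_succ, upd_cns_zero,
    upd_cns_zero]

theorem IndFor.indSg {n : ℕ} {Γ : Fml → Prop} (hΓ : ∀ φ, IsSigma n φ → Γ φ)
    (h : IndFor K Γ) : IndSg K n := by
  intro P hP v h0 hs
  obtain ⟨⟨φ, hφ, hφP⟩, -⟩ := hP.exists_fml dbl infinite_compl_range_dbl
  have key : ∀ m, Sat0 K (upd (spread (cns K.zero v)) 0 m) φ ↔ P (cns m v) := fun m => by
    rw [hφP, upd_spread_comp_dbl]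
  intro m
  rw [← key]
  refine h φ (hΓ φ hφ) _ _ ((key _).mpr h0) (fun m hm => (key _).mpr (hs m ((key _).mp hm))) m

theorem IsSigma.delta0_of_zero {φ : Fml} (h : IsSigma 0 φ) : Delta0 φ := by
  cases h
  assumption

theorem IndSg.mono [Nonempty K.M] {m n : ℕ} (hmn : m ≤ n) (h : IndSg K n) : IndSg K m :=
  fun P hP => h P (hP.mono hmn)

theorem IndSg.sgClosed [Fact (PAminus K)] : ∀ {n : ℕ}, IndSg K n → SgClosed K n
  | 0, _ => SgClosed.zero
  | n + 1, h => (IndSg.sgClosed (h.mono n.le_succ)).succ h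

theorem IndSg.pg_ind [Fact (PAminus K)] {n : ℕ} (h : IndSg K n) {P : (ℕ → K.M) → Prop}
    (hP : Pg K n P) (v : ℕ → K.M) (h0 : P (cns K.zero v))
    (hs : ∀ m, P (cns m v) → P (cns (K.add m K.one) v)) (m : K.M) : P (cns m v) := by
  have hn := h.sgClosed
  have hsg := hn.ball (f := fun v => K.add (v 1) K.one) ((IsT.var 1).add IsT.one)
    (hn.or ((D0.eq ((IsT.var 0).add (IsT.var 1)) (IsT.var 2)).not.sg n)
      (Sg.subst hP (s := fun z => cns (z 0) fun i => z (i + 3))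
        (isT_cns (IsT.var 0) fun i => IsT.var (i + 3))))
  by_contra hm
  have hlt : ∀ {a b : K.M}, a ≤ b → K.lt a (K.add b K.one) := (lt_add_one_iff_str K).mpr
  have key := h _ hsg (cns m v) ?_ ?_ m K.zero (hlt zero_le)
  · rcases key with hk | hk
    · exact hk (zero_add m)
    · exact hk h0
  · intro k _
    by_cases hk : K.add k K.zero = m
    · right
      have : k = m := (add_zero k).symm.trans hk
      exact this ▸ hm
    · exact Or.inl hk
  · intro j hj k _
    by_cases hk : k + (j + 1) = m
    · right
      have hk' : (k + 1) + j = m := by rw [← hk]; ring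
      rcases hj (k + 1) (hlt (hk' ▸ le_self_add)) with h1 | h1
      · exact absurd hk' h1
      · exact fun h2 => h1 (hs k h2)
    · exact Or.inl hk

theorem MISigma.sg {S : Str} {e : Emb S K} {n : ℕ} (h : MISigma e n) {P : (ℕ → K.M) → Prop} (hP : Sg K n P)
    (v : ℕ → K.M) (a : S.M) (h0 : P (cns K.zero v))
    (hs : ∀ m, K.lt m (e.j a) → P (cns m v) → P (cns (K.add m K.one) v)) (m : K.M)
    (hm : K.lt m (e.j a)) : P (cns m v) := by
  obtain ⟨⟨φ, hφ, hφP⟩, -⟩ := hP.exists_fml dbl infinite_compl_range_dbl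
  have key : ∀ m, Sat0 K (upd (spread (cns K.zero v)) 0 m) φ ↔ P (cns m v) := fun m => by
    rw [hφP, upd_spread_comp_dbl]
  rw [← key]
  exact h φ hφ _ _ a ((key _).mpr h0) (fun m hm h => (key _).mpr (hs m hm ((key _).mp h))) m hm

end Hierarchy

section Exponentiation

theorem emb_tval {S K : Str} (e : Emb S K) (v : ℕ → S.M) (t : Term) :
    e.j (tval S v t) = tval K (fun i => e.j (v i)) t := by
  induction t with
  | var i => rfl
  | zero => exact e.zero
  | one => exact e.one
  | add t u iht ihu => exact (e.add _ _).trans (by rw [iht, ihu]; rfl)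
  | mul t u iht ihu => exact (e.mul _ _).trans (by rw [iht, ihu]; rfl)

theorem emb_one_add_one {S K : Str} (e : Emb S K) : e.j (1 + 1) = 1 + 1 :=
  (e.add _ _).trans (congrArg₂ K.add e.one e.one)

theorem emb_upd {S K : Str} (e : Emb S K) (v : ℕ → S.M) (x : ℕ) (m : S.M) :
    (fun i => e.j (upd v x m i)) = upd (fun i => e.j (v i)) x (e.j m) := by
  funext i
  simp only [upd]
  split_ifs <;> rfl

theorem IsEndExt.mem_range {S K : Str} [Fact (PAminus K)] {e : Emb S K} (hend : IsEndExt e)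
    {b : K.M} {a : S.M} (hb : K.lt b (e.j a)) : ∃ b', e.j b' = b := by
  by_contra hn
  exact absurd (show e.j a < b from hend b hn a) (not_lt.mpr (le_of_lt (show b < e.j a from hb)))

theorem Delta0.absolute {S K : Str} [Fact (PAminus K)] {e : Emb S K} (hend : IsEndExt e)
    {φ : Fml} (hφ : Delta0 φ) :
    ∀ v : ℕ → S.M, Sat0 S v φ ↔ Sat0 K (fun i => e.j (v i)) φ := by
  have hb : ∀ (v : ℕ → S.M) (t : Term) (m : S.M),
      S.lt m (tval S v t) ↔ K.lt (e.j m) (tval K (fun i => e.j (v i)) t) := fun v t m => by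
    rw [e.lt_iff, emb_tval]
  induction hφ with
  | eq t u =>
    intro v
    change tval S v t = tval S v u ↔ tval K _ t = tval K _ u
    rw [← emb_tval, ← emb_tval, e.inj.eq_iff]
  | lt t u =>
    intro v
    change S.lt (tval S v t) (tval S v u) ↔ K.lt (tval K _ t) (tval K _ u)
    rw [e.lt_iff, emb_tval, emb_tval]
  | not _ ih => exact fun v => not_congr (ih v)
  | and _ _ ih ih' => exact fun v => and_congr (ih v) (ih' v)
  | or _ _ ih ih' => exact fun v => or_congr (ih v) (ih' v)
  | imp _ _ ih ih' => exact fun v => imp_congr (ih v) (ih' v)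
  | @ball x t φ _ ih =>
    intro v
    have ih' : ∀ m, Sat0 S (upd v x m) φ ↔ Sat0 K (upd (fun i => e.j (v i)) x (e.j m)) φ :=
      fun m => by rw [ih, emb_upd]
    constructor
    · intro h m hm
      obtain ⟨m', rfl⟩ := hend.mem_range (a := tval S v t) (by rwa [emb_tval])
      exact (ih' m').mp (h m' ((hb v t m').mpr hm))
    · intro h m hm
      exact (ih' m).mpr (h _ ((hb v t m).mp hm))
  | @bex x t φ _ ih =>
    intro v
    have ih' : ∀ m, Sat0 S (upd v x m) φ ↔ Sat0 K (upd (fun i => e.j (v i)) x (e.j m)) φ :=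
      fun m => by rw [ih, emb_upd]
    constructor
    · rintro ⟨m, hm, h⟩
      exact ⟨e.j m, (hb v t m).mp hm, (ih' m).mp h⟩
    · rintro ⟨m, hm, h⟩
      obtain ⟨m', rfl⟩ := hend.mem_range (a := tval S v t) (by rwa [emb_tval])
      exact ⟨m', (hb v t m').mpr hm, (ih' m').mpr h⟩

theorem Delta0.expAt_absolute {S K : Str} [Fact (PAminus K)] {e : Emb S K}
    (hend : IsEndExt e) {E : Fml} (hE : Delta0 E) (a b c : S.M) :
    ExpAt S E a b c ↔ ExpAt K E (e.j a) (e.j b) (e.j c) := by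
  refine (hE.absolute hend _).trans (iff_of_eq ?_)
  unfold ExpAt
  congr 1
  funext i
  split_ifs <;> rfl

theorem D0.expAt {K : Str} {E : Fml} (hE : Delta0 E) {f g h : (ℕ → K.M) → K.M}
    (hf : IsT K f) (hg : IsT K g) (hh : IsT K h) :
    D0 K (fun w => ExpAt K E (f w) (g w) (h w)) := by
  refine (D0.of_delta0 hE).subst
    (s := fun w i => if i = 0 then f w else if i = 1 then g w else h w) fun i => ?_
  split_ifs <;> assumption

theorem IndSg.divMod {K : Str} [Fact (PAminus K)] (h : IndSg K 0) (c d : K.M) (hd : 0 < d) :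
    ∃ u r, r < d ∧ c = u * d + r := by
  have hD : D0 K (fun w => ∃ u, K.lt u (K.add (w 0) K.one) ∧ ∃ r, K.lt r (w 1) ∧
      w 0 = K.add (K.mul u (w 1)) r) :=
    D0.bex (P := fun w => ∃ r, K.lt r (w 2) ∧ w 1 = K.add (K.mul (w 0) (w 2)) r)
      ((IsT.var 0).add .one) (D0.bex
        (P := fun w => w 2 = K.add (K.mul (w 1) (w 3)) (w 0)) (IsT.var 2)
        (D0.eq (IsT.var 2) (((IsT.var 1).mul (IsT.var 3)).add (IsT.var 0))))
  have key := h _ hD (fun _ => d) ⟨0, lt_add_one (0 : K.M), 0, hd, ?_⟩ ?_ c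
  · obtain ⟨u, -, r, hr, hc⟩ := key
    exact ⟨u, r, hr, hc⟩
  · change (0 : K.M) = 0 * d + 0
    simp
  · rintro m ⟨u, hu, r, hr, hm⟩
    change m = u * d + r at hm
    rcases (add_one_le_of_lt_str K (show r < d from hr)).eq_or_lt with hrd | hrd
    · refine ⟨u + 1, add_lt_add_left (show u < m + 1 from hu) 1, 0, hd, ?_⟩
      change m + 1 = (u + 1) * d + 0
      rw [hm, ← hrd]; ring
    · refine ⟨u, lt_of_lt_of_le (show u < m + 1 from hu) le_self_add, r + 1, hrd, ?_⟩
      change m + 1 = u * d + (r + 1)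
      rw [hm, add_assoc]

variable {S : Str} [Fact (PAminus S)] {E : Fml}

theorem IsExpDef.pos (hE : IsExpDef S E) (hind : IndSg S 0) {x p : S.M}
    (hp : ExpAt S E (1 + 1) x p) : 0 < p := by
  have hD : D0 S (fun w => ¬ ExpAt S E (S.add S.one S.one) (w 0) S.zero) :=
    (D0.expAt hE.delta0 (IsT.one.add .one) (IsT.var 0) .zero).not
  have key := hind _ hD (fun _ => 0) ?_ ?_ x
  · refine pos_of_ne_zero ?_
    rintro rfl
    exact key hp
  · intro h0
    exact zero_ne_one (hE.unique _ _ _ _ h0 (hE.base _))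
  · intro m hm hm'
    obtain ⟨r, hr⟩ := hE.total (1 + 1) m
    have h1 : 0 = r * (1 + 1) := hE.unique _ _ _ _ hm' (hE.step _ _ _ hr)
    rcases eq_or_ne r 0 with rfl | hr0
    · exact hm hr
    · exact absurd h1 (mul_pos (pos_of_ne_zero hr0) (by positivity)).ne

theorem IsExpDef.dvd_of_le (hE : IsExpDef S E) (hind : IndSg S 0) {y Y p q : S.M}
    (hy : y ≤ Y) (hp : ExpAt S E (1 + 1) y p) (hq : ExpAt S E (1 + 1) Y q) :
    ∃ w, q = w * p := by
  have hD : D0 S (fun w => ∀ y, S.lt y (S.add (w 1) S.one) → S.add y (w 0) = w 1 →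
      ∃ p, S.lt p (S.add (w 2) S.one) ∧ ExpAt S E (S.add S.one S.one) y p ∧
        ∃ z, S.lt z (S.add (w 2) S.one) ∧ w 2 = S.mul z p) :=
    D0.ball (P := fun w => S.add (w 0) (w 1) = w 2 →
        ∃ p, S.lt p (S.add (w 3) S.one) ∧ ExpAt S E (S.add S.one S.one) (w 0) p ∧
        ∃ z, S.lt z (S.add (w 3) S.one) ∧ w 3 = S.mul z p) ((IsT.var 1).add .one)
      (D0.imp (.eq ((IsT.var 0).add (IsT.var 1)) (IsT.var 2))
        (D0.bex (P := fun w => ExpAt S E (S.add S.one S.one) (w 1) (w 0) ∧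
            ∃ z, S.lt z (S.add (w 4) S.one) ∧ w 4 = S.mul z (w 0)) ((IsT.var 3).add .one)
          ((D0.expAt hE.delta0 (IsT.one.add .one) (IsT.var 1) (IsT.var 0)).and
            (D0.bex (P := fun w => w 5 = S.mul (w 0) (w 1)) ((IsT.var 4).add .one)
              (D0.eq (IsT.var 5) ((IsT.var 0).mul (IsT.var 1)))))))
  obtain ⟨d, rfl⟩ := exists_add_of_le hy
  have key := hind _ hD (cns (y + d) fun _ => q) ?_ ?_ d y
    ((lt_add_one_iff_str S).mpr le_self_add) rfl
  · obtain ⟨p', -, hp', z, -, hz⟩ := key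
    exact ⟨z, hE.unique _ _ _ _ hp' hp ▸ hz⟩
  · intro k _ hk
    change k + 0 = y + d at hk
    rw [add_zero] at hk
    subst hk
    refine ⟨q, lt_add_one q, hq, 1, ?_, (one_mul q).symm⟩
    exact (lt_add_one_iff_str S).mpr
      ((zero_add (1 : S.M)).symm.le.trans (add_one_le_of_lt_str S (hE.pos hind hq)))
  · intro j hj k _ hk
    change k + (j + 1) = y + d at hk
    have hk' : k + 1 + j = y + d := by rw [← hk]; ring
    obtain ⟨p', -, hp', z, -, hz⟩ :=
      hj (k + 1) ((lt_add_one_iff_str S).mpr (hk' ▸ le_self_add)) hk'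
    obtain ⟨r, hr⟩ := hE.total (1 + 1) k
    have h1 : p' = r * (1 + 1) := hE.unique _ _ _ _ hp' (hE.step _ _ _ hr)
    change q = z * p' at hz
    have hz' : q = (z * (1 + 1)) * r := by rw [hz, h1]; ring
    have hpos : 0 < q := hE.pos hind hq
    have h1r : 1 ≤ r := by
      have := add_one_le_of_lt_str S (hE.pos hind hr)
      rwa [zero_add] at this
    have h1z : 1 ≤ z * (1 + 1) := by
      have h0 : 0 < z * (1 + 1) := by
        refine pos_of_ne_zero fun h0 => ?_
        rw [h0, zero_mul] at hz'
        exact hpos.ne hz'.symm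
      have := add_one_le_of_lt_str S h0
      rwa [zero_add] at this
    refine ⟨r, (lt_add_one_iff_str S).mpr ?_, hr, z * (1 + 1),
      (lt_add_one_iff_str S).mpr ?_, hz'⟩
    · change r ≤ q
      rw [hz']
      exact le_mul_of_one_le_left zero_le h1z
    · change z * (1 + 1) ≤ q
      rw [hz']
      exact le_mul_of_one_le_right zero_le h1r

theorem IsExpDef.dvd_of_lt (hE : IsExpDef S E) (hind : IndSg S 0) {y Y p q : S.M}
    (hy : y < Y) (hp : ExpAt S E (1 + 1) y p) (hq : ExpAt S E (1 + 1) Y q) :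
    ∃ w, q = w * (p + p) := by
  obtain ⟨w, hw⟩ := hE.dvd_of_le hind (add_one_le_of_lt_str S hy) (hE.step _ _ _ hp) hq
  refine ⟨w, hw.trans ?_⟩
  change w * (p * (1 + 1)) = _
  ring

theorem IsExpDef.lt_of_lt (hE : IsExpDef S E) (hind : IndSg S 0) {y Y p q : S.M}
    (hy : y < Y) (hp : ExpAt S E (1 + 1) y p) (hq : ExpAt S E (1 + 1) Y q) : p < q := by
  obtain ⟨w, rfl⟩ := hE.dvd_of_lt hind hy hp hq
  have hpp := hE.pos hind hp
  have hw : 1 ≤ w := by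
    have h0 : 0 < w := by
      refine pos_of_ne_zero ?_
      rintro rfl
      have := hE.pos hind hq
      rw [zero_mul] at this
      exact this.false
    have := add_one_le_of_lt_str S h0
    rwa [zero_add] at this
  exact lt_of_lt_of_le (lt_add_of_pos_left p hpp) (le_mul_of_one_le_left zero_le hw)

end Exponentiation

section Digits

/-- The `x`-th binary digit of `c` is `1`, where `2 ^ x < q`, expressed inside `K`. -/
def DigitIn (K : Str) (E : Fml) (x c q : K.M) : Prop :=
  ∃ p, K.lt p q ∧ ExpAt K E (K.add K.one K.one) x p ∧
    ∃ u, K.lt u (K.add c K.one) ∧ ∃ r, K.lt r p ∧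
      c = K.add (K.add (K.mul u (K.add p p)) p) r

/-- Some `c` with `k ≤ c < q` codes only such `x < a` that have a `T`-witness below `b`. -/
def CodesBelow (K : Str) (E : Fml) (T : (ℕ → K.M) → Prop) (b k a q : K.M) (v : ℕ → K.M) : Prop :=
  ∃ c, K.lt c q ∧ K.lt k (K.add c K.one) ∧ ∀ x, K.lt x a → DigitIn K E x c q →
    ∃ y, K.lt y b ∧ T (cns y (cns x v))

theorem D0.digitIn {K : Str} {E : Fml} (hE : Delta0 E) {f g h : (ℕ → K.M) → K.M}
    (hf : IsT K f) (hg : IsT K g) (hh : IsT K h) :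
    D0 K (fun w => DigitIn K E (f w) (g w) (h w)) :=
  D0.subst (P := fun w => DigitIn K E (w 0) (w 1) (w 2))
    (D0.bex (P := fun w => ExpAt K E (K.add K.one K.one) (w 1) (w 0) ∧
        ∃ u, K.lt u (K.add (w 2) K.one) ∧ ∃ r, K.lt r (w 0) ∧
          w 2 = K.add (K.add (K.mul u (K.add (w 0) (w 0))) (w 0)) r) (IsT.var 2)
      ((D0.expAt hE (IsT.one.add .one) (IsT.var 1) (IsT.var 0)).and
        (D0.bex (P := fun w => ∃ r, K.lt r (w 1) ∧
            w 3 = K.add (K.add (K.mul (w 0) (K.add (w 1) (w 1))) (w 1)) r)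
          ((IsT.var 2).add .one)
          (D0.bex (P := fun w =>
              w 4 = K.add (K.add (K.mul (w 1) (K.add (w 2) (w 2))) (w 2)) (w 0))
            (IsT.var 1)
            (D0.eq (IsT.var 4) (((IsT.mul (IsT.var 1) ((IsT.var 2).add (IsT.var 2))).add
              (IsT.var 2)).add (IsT.var 0)))))))
    (isT_cns hf (isT_cns hg (isT_cns hh IsT.var)))

theorem SgClosed.pg_codesBelow {K : Str} [Nonempty K.M] {E : Fml} (hE : Delta0 E) {n : ℕ}
    (hn : SgClosed K n) {T : (ℕ → K.M) → Prop} (hT : Pg K n T) :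
    Pg K n (fun w => CodesBelow K E T (w 0) (w 1) (w 2) (w 3) (fun i => w (i + 4))) :=
  hn.pg_bex (P := fun w => K.lt (w 2) (K.add (w 0) K.one) ∧ ∀ x, K.lt x (w 3) →
      DigitIn K E x (w 0) (w 4) →
        ∃ y, K.lt y (w 1) ∧ T (cns y (cns x (fun i => w (i + 5))))) (IsT.var 3)
    (hn.pg_and ((D0.lt (IsT.var 2) ((IsT.var 0).add .one)).pg n)
      (hn.pg_ball (P := fun w => DigitIn K E (w 0) (w 1) (w 5) →
          ∃ y, K.lt y (w 2) ∧ T (cns y (cns (w 0) (fun i => w (i + 6))))) (IsT.var 3)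
        (hn.pg_imp (D0.digitIn hE (IsT.var 0) (IsT.var 1) (IsT.var 5))
          (hn.pg_bex (P := fun w => T (cns (w 0) (cns (w 1) (fun i => w (i + 7)))))
            (IsT.var 2) (hT.subst
              (isT_cns (IsT.var 0) (isT_cns (IsT.var 1) fun i => IsT.var (i + 7))))))))

variable {S K : Str} [Fact (PAminus S)] [Fact (PAminus K)] {E : Fml} {e : Emb S K}

theorem emb_pos (e : Emb S K) {p : S.M} (hp : 0 < p) : 0 < e.j p := by
  have h : K.lt (e.j S.zero) (e.j p) := (e.lt_iff _ _).mp hp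
  rwa [e.zero] at h

theorem digitIn_iff (hE : IsExpDef S E) (hind : IndSg S 0) (hend : IsEndExt e) {a q : S.M}
    (hq : ExpAt S E (1 + 1) a q) {x : K.M} (hx : K.lt x (e.j a)) (c : K.M) :
    DigitIn K E x c (e.j q) ↔ BitVia e E x c := by
  have habs : ∀ y p, ExpAt S E (1 + 1) y p ↔ ExpAt K E (1 + 1) (e.j y) (e.j p) := fun y p => by
    rw [hE.delta0.expAt_absolute hend, emb_one_add_one]
  constructor
  · rintro ⟨p, hpq, hp, u, -, r, hr, hc⟩
    obtain ⟨p, rfl⟩ := hend.mem_range hpq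
    obtain ⟨x, rfl⟩ := hend.mem_range hx
    exact ⟨x, p, rfl, (habs _ _).mpr hp, u, r, hr, hc⟩
  · rintro ⟨x, p, rfl, hp, u, r, hr, hc⟩
    have hxa : x < a := (e.lt_iff _ _).mpr hx
    refine ⟨e.j p, (e.lt_iff _ _).mp (hE.lt_of_lt hind hxa hp hq), (habs _ _).mp hp, u, ?_,
      r, hr, hc⟩
    refine (lt_add_one_iff_str K).mpr ?_
    change c = u * (e.j p + e.j p) + e.j p + r at hc
    have hp1 : 1 ≤ e.j p + e.j p := by
      have := add_one_le_of_lt_str K (emb_pos e (hE.pos hind hp))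
      rw [zero_add] at this
      exact this.trans le_self_add
    rw [hc]
    exact (le_mul_of_one_le_right zero_le hp1).trans (le_add_right le_self_add)

theorem exists_insert_digit (hE : IsExpDef S E) (hind : IndSg S 0) (hindK : IndSg K 0)
    (hend : IsEndExt e) {a q : S.M} (hq : ExpAt S E (1 + 1) a q) {x c : K.M}
    (hx : K.lt x (e.j a)) (hc : c < e.j q) (hxc : ¬ BitVia e E x c) :
    ∃ c', c < c' ∧ c' < e.j q ∧ ∀ y, BitVia e E y c' → BitVia e E y c ∨ y = x := by
  obtain ⟨x, rfl⟩ := hend.mem_range hx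
  obtain ⟨p, hp⟩ := hE.total (1 + 1) x
  have hdiv := hindK.divMod
  have hpos : ∀ {y p}, ExpAt S E (1 + 1) y p → 0 < e.j p := fun h => emb_pos e (hE.pos hind h)
  have hdvd : ∀ {y Y p q}, y < Y → ExpAt S E (1 + 1) y p → ExpAt S E (1 + 1) Y q →
      ∃ w, e.j q = w * (e.j p + e.j p) := by
    intro y Y p q hy hp hq
    obtain ⟨w, hw⟩ := hE.dvd_of_lt hind hy hp hq
    refine ⟨e.j w, ?_⟩
    rw [hw]
    refine (e.mul _ _).trans ?_
    exact congrArg (fun z => e.j w * z) (e.add p p)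
  obtain ⟨u, r, hr, hur⟩ := hdiv c (e.j p + e.j p) (add_pos (hpos hp) (hpos hp))
  have hrp : r < e.j p := by
    by_contra hn
    obtain ⟨u, r, h1, h2⟩ := digitOne_of_divMod hur (not_lt.mp hn) hr
    exact hxc ⟨x, p, rfl, hp, u, r, h1, h2⟩
  obtain ⟨w, hw⟩ := hdvd ((e.lt_iff _ _).mpr hx) hp hq
  refine ⟨c + e.j p, lt_add_of_pos_right c (hpos hp), add_lt_of_not_digitOne hw hur hrp hc, ?_⟩
  rintro _ ⟨y, p', rfl, hp', hd⟩
  rcases lt_trichotomy y x with hyx | rfl | hyx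
  · obtain ⟨w', hw'⟩ := hdvd hyx hp' hp
    exact Or.inl ⟨y, p', rfl, hp', digitOne_of_add_larger hdiv (hpos hp') hw' hd⟩
  · exact Or.inr rfl
  · obtain ⟨w', hw'⟩ := hdvd hyx hp hp'
    exact Or.inl ⟨y, p', rfl, hp', digitOne_of_add_smaller hdiv (hpos hp) hw' hur hrp hd⟩

theorem codesBelow_zero (hE : IsExpDef S E) (hind : IndSg S 0) (hend : IsEndExt e) {a q : S.M}
    (hq : ExpAt S E (1 + 1) a q) (T : (ℕ → K.M) → Prop) (b : K.M) (v : ℕ → K.M) :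
    CodesBelow K E T b K.zero (e.j a) (e.j q) v := by
  refine ⟨0, emb_pos e (hE.pos hind hq), lt_add_one (0 : K.M), fun x hx hd => ?_⟩
  obtain ⟨x, p, -, hp, h0⟩ := (digitIn_iff hE hind hend hq hx _).mp hd
  exact absurd h0 (not_digitOne_zero (emb_pos e (hE.pos hind hp)))

theorem not_codesBelow_self {T : (ℕ → K.M) → Prop} {b a q : K.M} {v : ℕ → K.M} :
    ¬ CodesBelow K E T b q a q v := by
  rintro ⟨c, hcq, hqc, -⟩
  exact absurd ((lt_add_one_iff_str K).mp hqc) (not_le.mpr (show c < q from hcq))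

theorem codesBelow_succ (hE : IsExpDef S E) (hind : IndSg S 0) (hindK : IndSg K 0)
    (hend : IsEndExt e) {a q : S.M} (hq : ExpAt S E (1 + 1) a q) {T : (ℕ → K.M) → Prop}
    {b b' c k x y : K.M} {v : ℕ → K.M} (hc : c < e.j q) (hk : k < c + 1) (hb : b ≤ b')
    (hcb : ∀ x, K.lt x (e.j a) → BitVia e E x c → ∃ y, K.lt y b ∧ T (cns y (cns x v)))
    (hx : K.lt x (e.j a)) (hxc : ¬ BitVia e E x c) (hy : y < b') (hT : T (cns y (cns x v))) :
    CodesBelow K E T b' (K.add k K.one) (e.j a) (e.j q) v := by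
  obtain ⟨c', hcc', hc', hins⟩ := exists_insert_digit hE hind hindK hend hq hx hc hxc
  refine ⟨c', hc', ?_, fun z hz hd => ?_⟩
  · exact (lt_add_one_iff_str K).mpr
      ((add_le_add_left ((lt_add_one_iff_str K).mp hk) 1).trans (add_one_le_of_lt_str K hcc'))
  · rcases hins z ((digitIn_iff hE hind hend hq hz _).mp hd) with h | rfl
    · obtain ⟨y', hy', h'⟩ := hcb z hz h
      exact ⟨y', lt_of_lt_of_le (show y' < b from hy') hb, h'⟩
    · exact ⟨y, hy, hT⟩

theorem MISigma.exists_bound {n : ℕ} (hMI : MISigma e (n + 1)) (hE : IsExpDef S E)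
    (hind : IndSg S 0) (hindK : IndSg K n) (hend : IsEndExt e) {T : (ℕ → K.M) → Prop}
    (hT : Pg K n T) (v : ℕ → K.M) (a : S.M) :
    ∃ b, ∀ m, K.lt m (e.j a) →
      ((∃ y, T (cns y (cns m v))) ↔ ∃ y, K.lt y b ∧ T (cns y (cns m v))) := by
  obtain ⟨q, hq⟩ := hE.total (1 + 1) a
  have hind0 : IndSg K 0 := hindK.mono n.zero_le
  have hsg := (hindK.sgClosed.pg_codesBelow hE.delta0 hT).ex
  obtain ⟨k, ⟨b, c, hc, hk, hcb⟩, hk'⟩ : ∃ k,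
      (∃ b, CodesBelow K E T b k (e.j a) (e.j q) v) ∧
      ¬ ∃ b, CodesBelow K E T b (K.add k K.one) (e.j a) (e.j q) v := by
    by_contra! hn
    obtain ⟨b, hb⟩ := hMI.sg hsg (cns (e.j a) (cns (e.j q) v)) (q + 1)
      ⟨0, codesBelow_zero hE hind hend hq T 0 v⟩
      (fun m _ hm => hn m hm) (e.j q) ((e.lt_iff _ _).mp (lt_add_one q))
    exact not_codesBelow_self hb
  refine ⟨b, fun m hm => ⟨?_, fun ⟨y, _, hy⟩ => ⟨y, hy⟩⟩⟩
  rintro ⟨y, hy⟩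
  by_contra hn
  refine hk' ⟨b + (y + 1), codesBelow_succ hE hind hind0 hend hq hc hk le_self_add
    (fun x hx hd => hcb x hx ((digitIn_iff hE hind hend hq hx _).mpr hd)) hm
    (fun hd => hn (hcb m hm ((digitIn_iff hE hind hend hq hm _).mpr hd)))
    (lt_of_lt_of_le (lt_add_one y) le_add_self) hy⟩

theorem exists_code_of_bound {n : ℕ} (hE : IsExpDef S E) (hind : IndSg S 0)
    (hindK : IndSg K n) (hend : IsEndExt e) {T : (ℕ → K.M) → Prop} (hT : Pg K n T)
    (v : ℕ → K.M) (a : S.M) {b : K.M} (hb : ∀ m, K.lt m (e.j a) →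
      ((∃ y, T (cns y (cns m v))) ↔ ∃ y, K.lt y b ∧ T (cns y (cns m v)))) :
    ∃ c, ∀ m, K.lt m (e.j a) → ((∃ y, T (cns y (cns m v))) ↔ BitVia e E m c) := by
  obtain ⟨q, hq⟩ := hE.total (1 + 1) a
  have hind0 : IndSg K 0 := hindK.mono n.zero_le
  have hpg := (hindK.sgClosed.pg_codesBelow hE.delta0 hT).subst
    (isT_cns (IsT.var 1) (isT_cns (IsT.var 0) fun i => IsT.var (i + 2)))
  obtain ⟨k, ⟨c, hc, hk, hcb⟩, hk'⟩ : ∃ k, CodesBelow K E T b k (e.j a) (e.j q) v ∧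
      ¬ CodesBelow K E T b (K.add k K.one) (e.j a) (e.j q) v := by
    by_contra! hn
    exact not_codesBelow_self (hindK.pg_ind hpg (cns b (cns (e.j a) (cns (e.j q) v)))
      (codesBelow_zero hE hind hend hq T b v) hn (e.j q))
  have hcb' : ∀ x, K.lt x (e.j a) → BitVia e E x c → ∃ y, K.lt y b ∧ T (cns y (cns x v)) :=
    fun x hx hd => hcb x hx ((digitIn_iff hE hind hend hq hx _).mpr hd)
  refine ⟨c, fun m hm => ⟨fun h => ?_, fun h => (hb m hm).mpr (hcb' m hm h)⟩⟩
  obtain ⟨y, hyb, hy⟩ := (hb m hm).mp h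
  by_contra hn
  exact hk' (codesBelow_succ hE hind hind0 hend hq hc hk le_rfl hcb' hm hn hyb hy)

theorem bitVia_induction (hE : IsExpDef S E) (hind : IndSg S 0) (hindK : IndSg K 0)
    (hend : IsEndExt e) {a : S.M} {c : K.M} (h0 : K.lt K.zero (e.j a) → BitVia e E K.zero c)
    (hs : ∀ m, K.lt (K.add m K.one) (e.j a) → BitVia e E m c → BitVia e E (K.add m K.one) c)
    (m : K.M) (hm : K.lt m (e.j a)) : BitVia e E m c := by
  obtain ⟨q, hq⟩ := hE.total (1 + 1) a
  have hD : D0 K (fun w => K.lt (w 0) (w 1) → DigitIn K E (w 0) (w 2) (w 3)) :=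
    (D0.lt (IsT.var 0) (IsT.var 1)).imp
      (D0.digitIn hE.delta0 (IsT.var 0) (IsT.var 2) (IsT.var 3))
  refine (digitIn_iff hE hind hend hq hm c).mp
    (hindK _ hD (cns (e.j a) (cns c fun _ => e.j q)) ?_ ?_ m hm)
  · exact fun h => (digitIn_iff hE hind hend hq h c).mpr (h0 h)
  · intro k hk hk'
    have hka : K.lt k (e.j a) := (lt_add_one k).trans (show k + 1 < e.j a from hk')
    exact (digitIn_iff hE hind hend hq hk' c).mpr
      (hs k hk' ((digitIn_iff hE hind hend hq hka c).mp (hk hka)))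

end Digits

/-- Lemma `lem:tfaeMind`.
Fix `n`.  Let `M ⊨ IΔ₀ + exp` (with `E` a `Δ₀` definition of exponentiation
witnessing `exp`), `K ⊨ IΣₙ`, and `M ⊆_e K`.  The following are equivalent:
(1) `K ⊨ M‑IΣₙ₊₁`;
(2) every `Σₙ₊₁` subset of an `M`-bounded interval, with parameters from
`K`, is coded by the binary digits of some `c ∈ K`;
(3) for every `Πₙ` formula `θ(x, y)` with parameters from `K` and `a ∈ M`,
`K ⊨ ∃b ∀x < a (∃y θ(x,y) ↔ ∃y < b θ(x,y))`. -/
theorem statement_9 (n : ℕ) (S K : Str) (hS : IDelta0 S)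
    (E : Fml) (hE : IsExpDef S E) (hK : ISigma K n)
    (e : Emb S K) (hend : IsEndExt e) :
    (MISigma e (n + 1) ↔
      (∀ φ : Fml, IsSigma (n + 1) φ → ∀ (v : ℕ → K.M) (x : ℕ) (a : S.M),
        ∃ c : K.M, ∀ m : K.M, K.lt m (e.j a) →
          (Sat0 K (upd v x m) φ ↔ BitVia e E m c))) ∧
    ((∀ φ : Fml, IsSigma (n + 1) φ → ∀ (v : ℕ → K.M) (x : ℕ) (a : S.M),
        ∃ c : K.M, ∀ m : K.M, K.lt m (e.j a) →
          (Sat0 K (upd v x m) φ ↔ BitVia e E m c)) ↔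
      (∀ θ : Fml, IsPi n θ → ∀ (v : ℕ → K.M) (x y : ℕ), x ≠ y → ∀ a : S.M,
        ∃ b : K.M, ∀ m : K.M, K.lt m (e.j a) →
          ((∃ k, Sat0 K (upd (upd v x m) y k) θ) ↔
            (∃ k, K.lt k b ∧ Sat0 K (upd (upd v x m) y k) θ)))) := by
  have : Fact (PAminus S) := ⟨hS.1⟩
  have : Fact (PAminus K) := ⟨hK.1⟩
  have hind : IndSg S 0 := IndFor.indSg (fun _ h => h.delta0_of_zero) hS.2
  have hindK : IndSg K n := IndFor.indSg (fun _ h => h) hK.2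
  have hcl : ∀ m < n + 1, SgClosed K m := fun m hm =>
    (hindK.mono (Nat.lt_succ_iff.mp hm)).sgClosed
  have h13 : MISigma e (n + 1) → ∀ θ : Fml, IsPi n θ → ∀ (v : ℕ → K.M) (x y : ℕ), x ≠ y →
      ∀ a : S.M, ∃ b : K.M, ∀ m : K.M, K.lt m (e.j a) →
        ((∃ k, Sat0 K (upd (upd v x m) y k) θ) ↔
          (∃ k, K.lt k b ∧ Sat0 K (upd (upd v x m) y k) θ)) := by
    intro h θ hθ v x y _ a
    have hT := (pg_of_isPi hθ fun m hm => hcl m (hm.trans n.lt_succ_self)).subst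
      ((fun i => (isT_upd y i).subst (isT_cns (IsT.var 0) fun i =>
        (isT_upd x i).subst fun i => IsT.var (i + 1))))
    exact h.exists_bound hE hind hindK hend hT v a
  have h32 : (∀ θ : Fml, IsPi n θ → ∀ (v : ℕ → K.M) (x y : ℕ), x ≠ y →
      ∀ a : S.M, ∃ b : K.M, ∀ m : K.M, K.lt m (e.j a) →
        ((∃ k, Sat0 K (upd (upd v x m) y k) θ) ↔
          (∃ k, K.lt k b ∧ Sat0 K (upd (upd v x m) y k) θ))) →
      ∀ φ : Fml, IsSigma (n + 1) φ → ∀ (v : ℕ → K.M) (x : ℕ) (a : S.M),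
        ∃ c : K.M, ∀ m : K.M, K.lt m (e.j a) →
          (Sat0 K (upd v x m) φ ↔ BitVia e E m c) := by
    intro h φ hφ v x a
    obtain ⟨Q, hQ, hPQ⟩ := (sg_of_isSigma hφ hcl).subst (isT_upd x)
    obtain ⟨-, θ, hθ, hθQ⟩ := hQ.exists_fml dbl infinite_compl_range_dbl
    obtain ⟨b, hb⟩ := h θ hθ (spread (cns K.zero (cns K.zero v))) 2 0 two_ne_zero a
    simp only [hθQ, upd_upd_spread_comp_dbl] at hb
    obtain ⟨c, hc⟩ := exists_code_of_bound hE hind hindK hend hQ.not v a hb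
    exact ⟨c, fun m hm => (hPQ (cns m v)).trans (hc m hm)⟩
  have h21 : (∀ φ : Fml, IsSigma (n + 1) φ → ∀ (v : ℕ → K.M) (x : ℕ) (a : S.M),
        ∃ c : K.M, ∀ m : K.M, K.lt m (e.j a) →
          (Sat0 K (upd v x m) φ ↔ BitVia e E m c)) → MISigma e (n + 1) := by
    intro h φ hφ v x a h0 hs m hm
    obtain ⟨c, hc⟩ := h φ hφ v x a
    refine (hc m hm).mpr (bitVia_induction hE hind (hindK.mono n.zero_le) hend
      (fun h => (hc _ h).mp h0) (fun k hk hk' => ?_) m hm)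
    have hka : K.lt k (e.j a) := (lt_add_one k).trans (show k + 1 < e.j a from hk)
    exact (hc _ hk).mp (hs k hka ((hc k hka).mpr hk'))
  exact ⟨⟨fun h => h32 (h13 h), h21⟩, ⟨fun h => h13 (h21 h), h32⟩⟩

end PaperArith
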